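/- arXiv:1410.7506 — 6 statements merged into one kernel-verified Lean document; each statement's English description precedes it below -/
import Mathlib

section
/- There exists a constant δ* > 0 such that every (1,ε)-restricted assignment instance with ε ∈ (0,1) admits a schedule of makespan at most (2 − δ*)·OPT_f, where OPT_f is the optimum value of the configuration LP. (This is the existential content of the paper's main theorem; the paper additionally shows such a schedule can be computed in polynomial time.) -/
open Finset

noncomputable section

open scoped Classical

/-- Size of a job: heavy jobs (in `JH`) have size 1, light jobs have size `ε`. -/
def jobSize {J : Type*} (JH : Finset J) (ε : ℝ) (j : J) : ℝ :=
  if j ∈ JH then 1 else ε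

/-- Load of machine `i` under schedule `σ`. -/
def machineLoad {M J : Type*} [Fintype J] [DecidableEq M]
    (JH : Finset J) (ε : ℝ) (σ : J → M) (i : M) : ℝ :=
  ∑ j ∈ Finset.univ.filter (fun j => σ j = i), jobSize JH ε j

/-- Feasibility of the configuration LP with makespan bound `T`:
there are nonnegative weights `y i C` on configurations, supported on configurations
assignable to `i` of total size at most `T`, summing to 1 on each machine,
and covering each job exactly once. -/
def ConfLPFeasible {M J : Type*} [Fintype M] [Fintype J] [DecidableEq M] [DecidableEq J]
    (JH : Finset J) (ε : ℝ) (Mach : J → Finset M) (T : ℝ) : Prop :=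
  ∃ y : M → Finset J → ℝ,
    (∀ i C, 0 ≤ y i C) ∧
    (∀ i C, y i C ≠ 0 → (∀ j ∈ C, i ∈ Mach j) ∧ ∑ j ∈ C, jobSize JH ε j ≤ T) ∧
    (∀ i, ∑ C : Finset J, y i C = 1) ∧
    (∀ j : J, ∑ i : M, ∑ C ∈ Finset.univ.filter (fun C : Finset J => j ∈ C), y i C = 1)

section LocalSearch

/-- A search that extends valid traces of bounded length, and otherwise lowers the value of some
trace element without raising the values of the older ones, cannot go on forever. -/
theorem false_of_trace_progress {S E : Type*} (Valid : S → List E → Prop) (val : S → E → ℕ)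
    (N : ℕ) (hN : ∀ s l, Valid s l → l.length ≤ N)
    (step : ∀ s l, Valid s l → (∃ e, Valid s (e :: l)) ∨
      ∃ s' e l', e :: l' <:+ l ∧ Valid s' (e :: l') ∧ val s' e < val s e ∧
        ∀ x ∈ l', val s' x ≤ val s x)
    (s : S) (hs : Valid s []) : False := by
  have key : ∀ n l s, N < l.length + n → Valid s l →
      ∃ s' e l', e :: l' <:+ l ∧ Valid s' (e :: l') ∧ val s' e < val s e ∧
        ∀ x ∈ l', val s' x ≤ val s x := by
    intro n
    induction n with
    | zero => intro l s hl hv; exact absurd (hN s l hv) (by omega)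
    | succ n ih =>
      intro l s hl hv
      rcases step s l hv with ⟨e, he⟩ | h
      · have inner : ∀ v s, val s e = v → Valid s (e :: l) →
            ∃ s' e l', e :: l' <:+ l ∧ Valid s' (e :: l') ∧ val s' e < val s e ∧
              ∀ x ∈ l', val s' x ≤ val s x := by
          intro v
          induction v using Nat.strong_induction_on with
          | _ v ihv =>
            intro s hsv hv
            obtain ⟨s', e', l', hsuf, hv', hlt, hle⟩ :=
              ih (e :: l) s (by simp only [List.length_cons]; omega) hv
            rcases List.suffix_cons_iff.mp hsuf with heq | hsuf
            · obtain ⟨rfl, rfl⟩ := List.cons.inj heq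
              obtain ⟨s'', e'', l'', hsuf', hv'', hlt', hle'⟩ := ihv _ (hsv ▸ hlt) s' rfl hv'
              have hsub := hsuf'.subset
              refine ⟨s'', e'', l'', hsuf', hv'', hlt'.trans_le (hle _ (hsub (by simp))), ?_⟩
              intro x hx
              exact (hle' x hx).trans (hle _ (hsub (by simp [hx])))
            · exact ⟨s', e', l', hsuf, hv', hlt, hle⟩
        exact inner _ s rfl he
      · exact h
  obtain ⟨s', e, l', hsuf, -⟩ := key (N + 1) [] s (by simp) hs
  simp at hsuf

variable {M J : Type*}

/-- The number of jobs of `P` that the partial schedule `σ` places on machine `i`. -/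
def placedCount (P : Finset J) (σ : J → Option M) (i : M) : ℕ :=
  #{j ∈ P | σ j = some i}

theorem placedCount_update_of_notMem {P : Finset J} (σ : J → Option M) {j : J} (hj : j ∉ P)
    (o : Option M) (k : M) : placedCount P (Function.update σ j o) k = placedCount P σ k := by
  unfold placedCount
  congr 1
  refine Finset.filter_congr fun x hx => ?_
  rw [Function.update_of_ne (by rintro rfl; exact hj hx)]

theorem filter_update_subset (P : Finset J) (σ : J → Option M) (j : J) {i k : M}
    (hk : k ≠ i) :
    {x ∈ P | Function.update σ j (some i) x = some k} ⊆ {x ∈ P | σ x = some k} := by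
  intro x hx
  simp only [mem_filter] at hx ⊢
  refine ⟨hx.1, ?_⟩
  rcases eq_or_ne x j with rfl | hne
  · simp [hk.symm] at hx
  · simpa [hne] using hx.2

theorem placedCount_update_le (P : Finset J) (σ : J → Option M) (j : J) {i k : M}
    (hk : k ≠ i) : placedCount P (Function.update σ j (some i)) k ≤ placedCount P σ k :=
  card_le_card (filter_update_subset P σ j hk)

theorem placedCount_update_lt {P : Finset J} {σ : J → Option M} {j : J} (hj : j ∈ P) {i k : M}
    (hk : k ≠ i) (hjk : σ j = some k) :
    placedCount P (Function.update σ j (some i)) k < placedCount P σ k := by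
  refine card_lt_card ⟨filter_update_subset P σ j hk, fun h => ?_⟩
  have := h (mem_filter.mpr ⟨hj, hjk⟩)
  simp [hk.symm] at this

theorem placedCount_update_self_le (P : Finset J) (σ : J → Option M) (j : J) (i : M) :
    placedCount P (Function.update σ j (some i)) i ≤ placedCount P σ i + 1 := by
  unfold placedCount
  refine (card_le_card (t := insert j {x ∈ P | σ x = some i}) ?_).trans (card_insert_le _ _)
  intro x hx
  rcases eq_or_ne x j with rfl | hne
  · simp
  · simpa [hne] using hx

/-- A job is active for `S` if it is unplaced or placed on a machine of `S`. -/
def Active (σ : J → Option M) (S : Finset M) (j : J) : Prop := ∀ i, σ j = some i → i ∈ S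

theorem Active.mono {σ : J → Option M} {S S' : Finset M} (h : S ⊆ S') {j : J}
    (hj : Active σ S j) : Active σ S' j := fun i hi => h (hj i hi)

theorem Active.update {σ : J → Option M} {S : Finset M} {j j' : J} (hne : j' ≠ j)
    (h : Active σ S j') (o : Option M) : Active (Function.update σ j o) S j' := by
  simpa [Active, hne] using h

/-- The reasons for which a machine enters the trace of the local search: it blocks a light job
(`full`), it blocks a heavy job by its light jobs (`drain`) or by its heavy job (`swap`). -/
inductive Blocker (M : Type*)
  | full (i : M)
  | drain (i : M)
  | swap (i : M)

namespace Blocker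

/-- The machines that the trace closes to light jobs. -/
def lightSet : List (Blocker M) → Finset M
  | [] => ∅
  | full i :: l => insert i (lightSet l)
  | drain i :: l => insert i (lightSet l)
  | swap _ :: l => lightSet l

/-- The machines in `swap` blockers. -/
def swapSet : List (Blocker M) → Finset M
  | [] => ∅
  | full _ :: l => swapSet l
  | drain _ :: l => swapSet l
  | swap i :: l => insert i (swapSet l)

/-- The machines whose heavy job the trace tries to move. -/
def heavySet : List (Blocker M) → Finset M
  | [] => ∅
  | full i :: l => insert i (heavySet l)
  | drain _ :: l => heavySet l
  | swap i :: l => insert i (heavySet l)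

/-- The newest blocker of the trace is a `drain` blocker. -/
def HeadDrain : List (Blocker M) → Prop
  | drain _ :: _ => True
  | _ => False

theorem lightSet_subset_cons (e : Blocker M) (l : List (Blocker M)) :
    lightSet l ⊆ lightSet (e :: l) := by
  cases e <;> simp [lightSet]

theorem swapSet_subset_cons (e : Blocker M) (l : List (Blocker M)) :
    swapSet l ⊆ swapSet (e :: l) := by
  cases e <;> simp [swapSet]

theorem heavySet_subset_cons (e : Blocker M) (l : List (Blocker M)) :
    heavySet l ⊆ heavySet (e :: l) := by
  cases e <;> simp [heavySet]

theorem swapSet_mono {l' l : List (Blocker M)} (h : l' <:+ l) : swapSet l' ⊆ swapSet l := by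
  obtain ⟨t, rfl⟩ := h
  induction t with
  | nil => rfl
  | cons e t ih => exact ih.trans (swapSet_subset_cons e _)

theorem lightSet_mono {l' l : List (Blocker M)} (h : l' <:+ l) : lightSet l' ⊆ lightSet l := by
  obtain ⟨t, rfl⟩ := h
  induction t with
  | nil => rfl
  | cons e t ih => exact ih.trans (lightSet_subset_cons e _)

theorem swapSet_subset_heavySet (l : List (Blocker M)) : swapSet l ⊆ heavySet l := by
  induction l with
  | nil => simp [swapSet]
  | cons e l ih =>
    intro i hi
    cases e <;> simp [heavySet, swapSet] at hi ⊢
    · exact Or.inr (ih hi)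
    · exact ih hi
    · exact hi.imp id (@ih i)

theorem exists_suffix_of_mem_swapSet {l : List (Blocker M)} {i : M} (h : i ∈ swapSet l) :
    ∃ l', swap i :: l' <:+ l := by
  induction l with
  | nil => simp [swapSet] at h
  | cons e l ih =>
    cases e with
    | full k => exact (ih h).imp fun _ h => h.trans (List.suffix_cons _ _)
    | drain k => exact (ih h).imp fun _ h => h.trans (List.suffix_cons _ _)
    | swap k =>
      rcases mem_insert.mp h with rfl | h
      · exact ⟨l, List.suffix_refl _⟩
      · exact (ih h).imp fun _ h => h.trans (List.suffix_cons _ _)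

theorem exists_first_mem_lightSet {l : List (Blocker M)} {i : M} (h : i ∈ lightSet l) :
    ∃ e l', e :: l' <:+ l ∧ i ∉ lightSet l' ∧ (e = full i ∨ e = drain i) := by
  induction l with
  | nil => simp [lightSet] at h
  | cons e l ih =>
    by_cases hi : i ∈ lightSet l
    · obtain ⟨e', l', hs, h'⟩ := ih hi
      exact ⟨e', l', hs.trans (List.suffix_cons _ _), h'⟩
    · refine ⟨e, l, List.suffix_refl _, hi, ?_⟩
      cases e <;> simp [lightSet, hi] at h ⊢ <;> exact h.symm

theorem exists_first_mem_heavySet {l : List (Blocker M)} {i : M} (h : i ∈ heavySet l) :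
    ∃ e l', e :: l' <:+ l ∧ i ∉ heavySet l' ∧ (e = full i ∨ e = swap i) := by
  induction l with
  | nil => simp [heavySet] at h
  | cons e l ih =>
    by_cases hi : i ∈ heavySet l
    · obtain ⟨e', l', hs, h'⟩ := ih hi
      exact ⟨e', l', hs.trans (List.suffix_cons _ _), h'⟩
    · refine ⟨e, l, List.suffix_refl _, hi, ?_⟩
      cases e <;> simp [heavySet, hi] at h ⊢ <;> exact h.symm

end Blocker

variable [Fintype J]

/-- The jobs that a partial schedule leaves unplaced. -/
def unplaced (σ : J → Option M) : Finset J := {j | σ j = none}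

theorem card_unplaced_update_lt {σ : J → Option M} {j : J} (hj : σ j = none) (i : M) :
    #(unplaced (Function.update σ j (some i))) < #(unplaced σ) := by
  refine card_lt_card ⟨fun x hx => ?_, fun h => ?_⟩
  · rcases eq_or_ne x j with rfl | hne
    · simp [unplaced] at hx
    · simpa [unplaced, hne] using hx
  · have := h (show j ∈ unplaced σ by simp [unplaced, hj])
    simp [unplaced] at this

theorem unplaced_update {σ : J → Option M} {j : J} (hj : σ j ≠ none) (i : M) :
    unplaced (Function.update σ j (some i)) = unplaced σ := by
  ext x
  rcases eq_or_ne x j with rfl | hne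
  · simp [unplaced, hj]
  · simp [unplaced, hne]

theorem sum_eq_sum_placed_add_sum_unplaced [Fintype M] {R : Type*} [AddCommMonoid R]
    (σ : J → Option M) (z : J → R) :
    ∑ j, z j = ∑ i, (∑ j with σ j = some i, z j) + ∑ j ∈ unplaced σ, z j := by
  rw [← Finset.sum_fiberwise univ σ z, Fintype.sum_option, add_comm, unplaced]

open Blocker

/-- A partial schedule with at most one heavy job per machine, at most `b` light jobs per machine,
and at most `a` light jobs next to a heavy one. -/
structure Feasible (JH : Finset J) (Mach : J → Finset M) (a b : ℕ) (σ : J → Option M) :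
    Prop where
  mem : ∀ j i, σ j = some i → i ∈ Mach j
  heavy_le : ∀ i, placedCount JH σ i ≤ 1
  light_le : ∀ i, placedCount JHᶜ σ i ≤ b
  mixed : ∀ i, placedCount JH σ i = 1 → placedCount JHᶜ σ i ≤ a

/-- The light jobs on `i` that can be placed nowhere else outside `S`. -/
def stuck (JH : Finset J) (Mach : J → Finset M) (σ : J → Option M) (S : Finset M) (i : M) :
    Finset J :=
  {j ∈ JHᶜ | σ j = some i ∧ ∀ k ∈ Mach j, k ∈ S ∨ σ j = some k}

/-- The traces of the local search, newest blocker first. -/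
def Trace (JH : Finset J) (Mach : J → Finset M) (a : ℕ) (σ : J → Option M) :
    List (Blocker M) → Prop
  | [] => True
  | full i :: l => Trace JH Mach a σ l ∧ i ∉ lightSet l ∧
      ∃ j ∉ JH, i ∈ Mach j ∧ Active σ (lightSet l) j
  | drain i :: l => Trace JH Mach a σ l ∧ ¬ HeadDrain l ∧ i ∉ lightSet l ∧ i ∉ swapSet l ∧
      placedCount JH σ i = 0 ∧ #(stuck JH Mach σ (lightSet l) i) ≤ a ∧
      ∃ j ∈ JH, i ∈ Mach j ∧ Active σ (heavySet l) j
  | swap i :: l => Trace JH Mach a σ l ∧ ¬ HeadDrain l ∧ i ∉ lightSet l ∧ i ∉ swapSet l ∧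
      placedCount JHᶜ σ i ≤ a ∧ ∃ j ∈ JH, i ∈ Mach j ∧ Active σ (heavySet l) j

/-- The number of jobs which a blocker wants to move away. -/
def blockerValue (JH : Finset J) (σ : J → Option M) : Blocker M → ℕ
  | full i => placedCount JH σ i + placedCount JHᶜ σ i
  | drain i => placedCount JH σ i + placedCount JHᶜ σ i
  | swap i => placedCount JH σ i

section Moves

variable {JH : Finset J} {Mach : J → Finset M} {a b : ℕ} {σ : J → Option M}

theorem Trace.of_cons {e : Blocker M} {l : List (Blocker M)} (h : Trace JH Mach a σ (e :: l)) :
    Trace JH Mach a σ l := by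
  cases e <;> exact h.1

theorem Trace.suffix {l' l : List (Blocker M)} (hs : l' <:+ l) (h : Trace JH Mach a σ l) :
    Trace JH Mach a σ l' := by
  obtain ⟨t, rfl⟩ := hs
  induction t with
  | nil => exact h
  | cons e t ih => exact ih h.of_cons

theorem Trace.length_le [Fintype M] {l : List (Blocker M)} (h : Trace JH Mach a σ l) :
    l.length ≤ 2 * Fintype.card M := by
  have : l.length = #(lightSet l) + #(swapSet l) := by
    induction l with
    | nil => simp [lightSet, swapSet]
    | cons e l ih =>
      have := ih h.of_cons
      cases e with
      | full i => simp [lightSet, swapSet, card_insert_of_notMem h.2.1]; omega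
      | drain i => simp [lightSet, swapSet, card_insert_of_notMem h.2.2.1]; omega
      | swap i => simp [lightSet, swapSet, card_insert_of_notMem h.2.2.2.1]; omega
  have h₁ := card_le_univ (lightSet l)
  have h₂ := card_le_univ (swapSet l)
  omega

theorem stuck_update_subset (S : Finset M) (j : J) {i k : M} (hk : k ≠ i) :
    stuck JH Mach (Function.update σ j (some i)) S k ⊆ stuck JH Mach σ S k := by
  intro x hx
  rcases eq_or_ne x j with rfl | hne
  · simp [stuck, hk.symm] at hx
  · simpa [stuck, hne] using hx

theorem Feasible.update_light (hσ : Feasible JH Mach a b σ) {j : J} (hj : j ∉ JH) {i : M}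
    (hi : i ∈ Mach j) (hb : placedCount JHᶜ σ i < b)
    (ha : placedCount JH σ i = 1 → placedCount JHᶜ σ i < a) :
    Feasible JH Mach a b (Function.update σ j (some i)) where
  mem x k hx := by
    rcases eq_or_ne x j with rfl | hne
    · obtain rfl : i = k := by simpa using hx
      exact hi
    · exact hσ.mem x k (by simpa [hne] using hx)
  heavy_le k := by
    rw [placedCount_update_of_notMem σ hj]
    exact hσ.heavy_le k
  light_le k := by
    rcases eq_or_ne k i with rfl | hne
    · exact (placedCount_update_self_le _ σ j k).trans hb
    · exact (placedCount_update_le _ σ j hne).trans (hσ.light_le k)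
  mixed k hk := by
    rw [placedCount_update_of_notMem σ hj] at hk
    rcases eq_or_ne k i with rfl | hne
    · exact (placedCount_update_self_le _ σ j k).trans (ha hk)
    · exact (placedCount_update_le _ σ j hne).trans (hσ.mixed k hk)

theorem Feasible.update_heavy (hσ : Feasible JH Mach a b σ) {j : J} (hj : j ∈ JH) {i : M}
    (hi : i ∈ Mach j) (h₀ : placedCount JH σ i = 0) (ha : placedCount JHᶜ σ i ≤ a) :
    Feasible JH Mach a b (Function.update σ j (some i)) where
  mem x k hx := by
    rcases eq_or_ne x j with rfl | hne
    · obtain rfl : i = k := by simpa using hx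
      exact hi
    · exact hσ.mem x k (by simpa [hne] using hx)
  heavy_le k := by
    rcases eq_or_ne k i with rfl | hne
    · exact (placedCount_update_self_le _ σ j k).trans (by omega)
    · exact (placedCount_update_le _ σ j hne).trans (hσ.heavy_le k)
  light_le k := by
    rw [placedCount_update_of_notMem σ (by simpa using hj)]
    exact hσ.light_le k
  mixed k hk := by
    rw [placedCount_update_of_notMem σ (by simpa using hj)]
    rcases eq_or_ne k i with rfl | hne
    · exact ha
    · refine hσ.mixed k (le_antisymm (hσ.heavy_le k) ?_)
      exact hk ▸ placedCount_update_le _ σ j hne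

theorem Trace.update_light {l : List (Blocker M)} (h : Trace JH Mach a σ l) {j : J} (hj : j ∉ JH)
    (hact : ¬ Active σ (lightSet l.tail) j) {i : M} (hi : i ∉ lightSet l)
    (ha : i ∈ swapSet l → placedCount JHᶜ σ i < a) :
    Trace JH Mach a (Function.update σ j (some i)) l := by
  induction l with
  | nil => trivial
  | cons e l ih =>
    have hl : Trace JH Mach a (Function.update σ j (some i)) l := by
      refine ih h.of_cons (fun hc => hact (hc.mono ?_)) (fun hc => hi (lightSet_subset_cons e l hc))
        (fun hc => ha (swapSet_subset_cons e l hc))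
      exact lightSet_mono (List.tail_suffix l)
    cases e with
    | full k =>
      obtain ⟨-, h₁, x, hx, hk, hxa⟩ := h
      exact ⟨hl, h₁, x, hx, hk, hxa.update (by rintro rfl; exact hact hxa) _⟩
    | drain k =>
      obtain ⟨-, h₁, h₂, h₃, h₄, h₅, x, hx, hk, hxa⟩ := h
      have hne : k ≠ i := by rintro rfl; simp [lightSet] at hi
      refine ⟨hl, h₁, h₂, h₃, ?_, (card_le_card (stuck_update_subset _ j hne)).trans h₅, x, hx, hk,
        hxa.update (by rintro rfl; exact hj hx) _⟩
      rwa [placedCount_update_of_notMem σ hj]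
    | swap k =>
      obtain ⟨-, h₁, h₂, h₃, h₄, x, hx, hk, hxa⟩ := h
      refine ⟨hl, h₁, h₂, h₃, ?_, x, hx, hk, hxa.update (by rintro rfl; exact hj hx) _⟩
      rcases eq_or_ne k i with rfl | hne
      · exact (placedCount_update_self_le _ σ j k).trans (ha (by simp [swapSet]))
      · exact (placedCount_update_le _ σ j hne).trans h₄

theorem Trace.update_heavy {l : List (Blocker M)} (h : Trace JH Mach a σ l) {j : J} (hj : j ∈ JH)
    (hact : ¬ Active σ (heavySet l.tail) j) {i : M} (hi : i ∉ lightSet l) (hi' : i ∉ swapSet l) :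
    Trace JH Mach a (Function.update σ j (some i)) l := by
  have hj' : j ∉ JHᶜ := by simpa using hj
  induction l with
  | nil => trivial
  | cons e l ih =>
    have hl : Trace JH Mach a (Function.update σ j (some i)) l := by
      refine ih h.of_cons (fun hc => hact (hc.mono ?_)) (fun hc => hi (lightSet_subset_cons e l hc))
        (fun hc => hi' (swapSet_subset_cons e l hc))
      cases l with
      | nil => rfl
      | cons e' l => exact heavySet_subset_cons e' l
    cases e with
    | full k =>
      obtain ⟨-, h₁, x, hx, hk, hxa⟩ := h
      exact ⟨hl, h₁, x, hx, hk, hxa.update (by rintro rfl; exact hx hj) _⟩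
    | drain k =>
      obtain ⟨-, h₁, h₂, h₃, h₄, h₅, x, hx, hk, hxa⟩ := h
      have hne : k ≠ i := by rintro rfl; simp [lightSet] at hi
      refine ⟨hl, h₁, h₂, h₃, ?_, (card_le_card (stuck_update_subset _ j hne)).trans h₅, x, hx, hk,
        hxa.update (by rintro rfl; exact hact hxa) _⟩
      exact Nat.le_zero.mp (h₄ ▸ placedCount_update_le _ σ j hne)
    | swap k =>
      obtain ⟨-, h₁, h₂, h₃, h₄, x, hx, hk, hxa⟩ := h
      refine ⟨hl, h₁, h₂, h₃, ?_, x, hx, hk, hxa.update (by rintro rfl; exact hact hxa) _⟩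
      rwa [placedCount_update_of_notMem σ hj']

theorem blockerValue_update_light_le {l : List (Blocker M)} {j : J} (hj : j ∉ JH) {i : M}
    (hi : i ∉ lightSet l) : ∀ x ∈ l,
    blockerValue JH (Function.update σ j (some i)) x ≤ blockerValue JH σ x := by
  induction l with
  | nil => simp
  | cons e l ih =>
    intro x hx
    rcases List.mem_cons.mp hx with rfl | hx
    · cases x with
      | full k =>
        have hne : k ≠ i := by rintro rfl; simp [lightSet] at hi
        exact add_le_add (placedCount_update_le _ σ j hne) (placedCount_update_le _ σ j hne)
      | drain k =>
        have hne : k ≠ i := by rintro rfl; simp [lightSet] at hi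
        exact add_le_add (placedCount_update_le _ σ j hne) (placedCount_update_le _ σ j hne)
      | swap k => exact (placedCount_update_of_notMem σ hj _ k).le
    · exact ih (fun hc => hi (lightSet_subset_cons e l hc)) x hx

theorem blockerValue_update_heavy_le {l : List (Blocker M)} (j : J) {i : M}
    (hi : i ∉ lightSet l) (hi' : i ∉ swapSet l) : ∀ x ∈ l,
    blockerValue JH (Function.update σ j (some i)) x ≤ blockerValue JH σ x := by
  induction l with
  | nil => simp
  | cons e l ih =>
    intro x hx
    rcases List.mem_cons.mp hx with rfl | hx
    · cases x with
      | full k =>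
        have hne : k ≠ i := by rintro rfl; simp [lightSet] at hi
        exact add_le_add (placedCount_update_le _ σ j hne) (placedCount_update_le _ σ j hne)
      | drain k =>
        have hne : k ≠ i := by rintro rfl; simp [lightSet] at hi
        exact add_le_add (placedCount_update_le _ σ j hne) (placedCount_update_le _ σ j hne)
      | swap k =>
        have hne : k ≠ i := by rintro rfl; simp [swapSet] at hi'
        exact placedCount_update_le _ σ j hne
    · exact ih (fun hc => hi (lightSet_subset_cons e l hc))
        (fun hc => hi' (swapSet_subset_cons e l hc)) x hx

/-- Some move lowers the value of a blocker of the trace, keeping the older part of the trace. -/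
def Improvable (JH : Finset J) (Mach : J → Finset M) (a b : ℕ) (σ : J → Option M)
    (l : List (Blocker M)) : Prop :=
  ∃ σ' e l', e :: l' <:+ l ∧
    (Feasible JH Mach a b σ' ∧ unplaced σ' = unplaced σ ∧ Trace JH Mach a σ' (e :: l')) ∧
    blockerValue JH σ' e < blockerValue JH σ e ∧
    ∀ x ∈ l', blockerValue JH σ' x ≤ blockerValue JH σ x

theorem Improvable.of_suffix {l' l : List (Blocker M)} (hs : l' <:+ l)
    (h : Improvable JH Mach a b σ l') : Improvable JH Mach a b σ l := by
  obtain ⟨σ', e, l'', hs', h⟩ := h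
  exact ⟨σ', e, l'', hs'.trans hs, h⟩

theorem improvable_of_light {l : List (Blocker M)} (hσ : Feasible JH Mach a b σ)
    (hopt : ∀ σ', Feasible JH Mach a b σ' → #(unplaced σ) ≤ #(unplaced σ'))
    (h : Trace JH Mach a σ l) (hswap : ∀ i ∈ swapSet l, placedCount JH σ i = 1)
    {j : J} (hj : j ∉ JH) (hact : Active σ (lightSet l) j) {i : M} (hi : i ∈ Mach j)
    (hil : i ∉ lightSet l) (hb : placedCount JHᶜ σ i < b)
    (ha : placedCount JH σ i = 1 → placedCount JHᶜ σ i < a) : Improvable JH Mach a b σ l := by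
  have hfeas := hσ.update_light hj hi hb ha
  rcases hjk : σ j with _ | k
  · exact absurd (hopt _ hfeas) (not_le.mpr (card_unplaced_update_lt hjk i))
  obtain ⟨e, l', hs, hk, he⟩ := exists_first_mem_lightSet (hact k hjk)
  have hi' : i ∉ lightSet (e :: l') := fun hc => hil (lightSet_mono hs hc)
  refine ⟨_, e, l', hs, ⟨hfeas, unplaced_update (by simp [hjk]) i,
    (h.suffix hs).update_light hj (fun hc => hk (hc k hjk)) hi'
      fun hc => ha (hswap i (swapSet_mono hs hc))⟩, ?_,
    blockerValue_update_light_le hj fun hc => hi' (lightSet_subset_cons e l' hc)⟩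
  have hne : k ≠ i := by
    rintro rfl
    rcases he with rfl | rfl <;> simp [lightSet] at hi'
  have hlt := placedCount_update_lt (P := JHᶜ) (by simpa using hj) hne hjk
  have heq := placedCount_update_of_notMem σ hj (some i) k
  rcases he with rfl | rfl <;> simp only [blockerValue] <;> omega

theorem improvable_of_heavy {l : List (Blocker M)} (hσ : Feasible JH Mach a b σ)
    (hopt : ∀ σ', Feasible JH Mach a b σ' → #(unplaced σ) ≤ #(unplaced σ'))
    (h : Trace JH Mach a σ l) {j : J} (hj : j ∈ JH) (hact : Active σ (heavySet l) j) {i : M}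
    (hi : i ∈ Mach j) (hil : i ∉ lightSet l) (his : i ∉ swapSet l)
    (h₀ : placedCount JH σ i = 0) (ha : placedCount JHᶜ σ i ≤ a) :
    Improvable JH Mach a b σ l := by
  have hfeas := hσ.update_heavy hj hi h₀ ha
  rcases hjk : σ j with _ | k
  · exact absurd (hopt _ hfeas) (not_le.mpr (card_unplaced_update_lt hjk i))
  obtain ⟨e, l', hs, hk, he⟩ := exists_first_mem_heavySet (hact k hjk)
  have hi' : i ∉ lightSet (e :: l') := fun hc => hil (lightSet_mono hs hc)
  have hi'' : i ∉ swapSet (e :: l') := fun hc => his (swapSet_mono hs hc)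
  refine ⟨_, e, l', hs, ⟨hfeas, unplaced_update (by simp [hjk]) i,
    (h.suffix hs).update_heavy hj (fun hc => hk (hc k hjk)) hi' hi''⟩, ?_,
    blockerValue_update_heavy_le j (fun hc => hi' (lightSet_subset_cons e l' hc))
      fun hc => hi'' (swapSet_subset_cons e l' hc)⟩
  have hne : k ≠ i := by
    rintro rfl
    rcases he with rfl | rfl
    · simp [lightSet] at hi'
    · simp [swapSet] at hi''
  have hlt := placedCount_update_lt hj hne hjk
  have heq := placedCount_update_of_notMem (P := JHᶜ) σ (by simpa using hj) (some i) k
  rcases he with rfl | rfl <;> simp only [blockerValue] <;> omega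

end Moves

/-- A set of jobs which fits on `i` and holds at most one heavy job, at most `c` light jobs, and
at most `c₀` light jobs next to a heavy one. -/
structure IsConfig (JH : Finset J) (Mach : J → Finset M) (c c₀ : ℕ) (i : M) (C : Finset J) :
    Prop where
  mem : ∀ j ∈ C, i ∈ Mach j
  heavy_le : #{j ∈ C | j ∈ JH} ≤ 1
  light_le : #{j ∈ C | j ∈ JHᶜ} ≤ c
  mixed : #{j ∈ C | j ∈ JH} = 1 → #{j ∈ C | j ∈ JHᶜ} ≤ c₀

/-- Every dual solution that respects all pairs in `conf` has nonnegative balance. -/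
def DualBounded [Fintype M] (conf : M → Finset J → Prop) : Prop :=
  ∀ (z : J → ℝ) (y : M → ℝ), (∀ i C, conf i C → ∑ j ∈ C, z j ≤ y i) → ∑ j, z j ≤ ∑ i, y i

section Step

variable {JH : Finset J} {Mach : J → Finset M} {a b : ℕ} {σ : J → Option M}

theorem card_lightSet_mul_le {l : List (Blocker M)} (h : Trace JH Mach a σ l) (v : M → ℕ)
    (Y g : ℕ) (hfull : ∀ i, full i ∈ l → Y + g ≤ v i) (hdrain : ∀ i, drain i ∈ l → Y ≤ v i + g) :
    #(lightSet l) * Y ≤ ∑ i ∈ lightSet l, v i + g ∧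
      (¬ HeadDrain l → #(lightSet l) * Y ≤ ∑ i ∈ lightSet l, v i) := by
  induction l with
  | nil => simp [lightSet]
  | cons e l ih =>
    obtain ⟨ih₁, ih₂⟩ := ih h.of_cons (fun i hi => hfull i (by simp [hi]))
      (fun i hi => hdrain i (by simp [hi]))
    cases e with
    | full i =>
      have := hfull i (by simp)
      simp only [lightSet, card_insert_of_notMem h.2.1, sum_insert h.2.1, add_mul, one_mul]
      exact ⟨by omega, fun _ => by omega⟩
    | drain i =>
      have := hdrain i (by simp)
      have := ih₂ h.2.1
      simp only [lightSet, card_insert_of_notMem h.2.2.1, sum_insert h.2.2.1, add_mul, one_mul]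
      exact ⟨by omega, fun hc => absurd trivial hc⟩
    | swap i => exact ⟨ih₁, fun _ => ih₂ h.2.1⟩

theorem trace_extendable_or_improvable [Fintype M] {c c₀ : ℕ} {l : List (Blocker M)}
    (hc₀ : c₀ ≤ a) (hab : a < b) (hc : 2 * c + c₀ ≤ 3 * a + 2) (hcb : 2 * c ≤ a + b + 1)
    (hσ : Feasible JH Mach a b σ)
    (hopt : ∀ σ', Feasible JH Mach a b σ' → #(unplaced σ) ≤ #(unplaced σ'))
    (hun : (unplaced σ).Nonempty) (hdual : DualBounded (IsConfig JH Mach c c₀))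
    (h : Trace JH Mach a σ l) :
    (∃ e, Trace JH Mach a σ (e :: l)) ∨ Improvable JH Mach a b σ l := by
  by_contra! hcon
  obtain ⟨hext, himp⟩ := hcon
  have hswap : ∀ i ∈ swapSet l, placedCount JH σ i = 1 := by
    intro i hi
    obtain ⟨l', hs⟩ := exists_suffix_of_mem_swapSet hi
    obtain ⟨ht, -, h₁, h₂, h₃, j, hj, hij, hact⟩ := h.suffix hs
    by_contra hne
    have hle := hσ.heavy_le i
    exact himp ((improvable_of_heavy hσ hopt ht hj hact hij h₁ h₂ (by omega) h₃).of_suffix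
      ((List.suffix_cons _ _).trans hs))
  have suffix_of_mem : ∀ e ∈ l, ∃ l', e :: l' <:+ l := by
    intro e he
    obtain ⟨s, t, rfl⟩ := List.append_of_mem he
    exact ⟨t, List.suffix_append _ _⟩
  have hfull : ∀ i, full i ∈ l →
      (placedCount JH σ i = 1 ∧ a ≤ placedCount JHᶜ σ i) ∨ b ≤ placedCount JHᶜ σ i := by
    intro i hi
    obtain ⟨l', hs⟩ := suffix_of_mem _ hi
    obtain ⟨ht, h₁, j, hj, hij, hact⟩ := h.suffix hs
    by_contra! hne
    have hs' := (List.suffix_cons _ _).trans hs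
    exact himp ((improvable_of_light hσ hopt ht (fun k hk => hswap k (swapSet_mono hs' hk)) hj hact
      hij h₁ hne.2 hne.1).of_suffix hs')
  have hdrain : ∀ i, drain i ∈ l → a + 1 ≤ placedCount JHᶜ σ i := by
    intro i hi
    obtain ⟨l', hs⟩ := suffix_of_mem _ hi
    obtain ⟨ht, -, h₁, h₂, h₃, -, j, hj, hij, hact⟩ := h.suffix hs
    by_contra! hne
    exact himp ((improvable_of_heavy hσ hopt ht hj hact hij h₁ h₂ h₃ (by omega)).of_suffix
      ((List.suffix_cons _ _).trans hs))
  have hclosed : ∀ j ∉ JH, Active σ (lightSet l) j → Mach j ⊆ lightSet l := by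
    intro j hj hact i hi
    by_contra hil
    exact hext (full i) ⟨h, hil, j, hj, hi, hact⟩
  have hstuck : ∀ i ∈ lightSet l, placedCount JHᶜ σ i ≤ #(stuck JH Mach σ (lightSet l) i) := by
    intro i hi
    refine card_le_card fun j hj => ?_
    simp only [mem_filter, mem_compl, stuck] at hj ⊢
    refine ⟨hj.1, hj.2, fun k hk => Or.inl (hclosed j hj.1 ?_ hk)⟩
    intro i' hi'
    rw [hj.2] at hi'
    exact Option.some.inj hi' ▸ hi
  have hhead : ¬ HeadDrain l := by
    intro hd
    match l, hd with
    | drain i :: l, _ =>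
      obtain ⟨-, -, -, -, -, h₅, -⟩ := h
      have h₁ := hdrain i (by simp)
      have h₂ : placedCount JHᶜ σ i ≤ #(stuck JH Mach σ (lightSet l) i) := by
        refine card_le_card fun j hj => ?_
        simp only [mem_filter, mem_compl, stuck] at hj ⊢
        refine ⟨hj.1, hj.2, fun k hk => ?_⟩
        have := hclosed j hj.1 (fun i' hi' => ?_) hk
        · rcases mem_insert.mp this with rfl | hk
          · exact Or.inr hj.2
          · exact Or.inl hk
        · rw [hj.2] at hi'
          simp [lightSet, Option.some.inj hi']
      omega
  have hheavy : ∀ j ∈ JH, Active σ (heavySet l) j → ∀ i ∈ Mach j, i ∉ lightSet l →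
      i ∉ swapSet l → a + 1 ≤ #(stuck JH Mach σ (lightSet l) i) := by
    intro j hj hact i hi h₁ h₂
    by_contra! hlt
    have hle := hσ.heavy_le i
    by_cases hone : placedCount JH σ i = 1
    · exact hext (swap i) ⟨h, hhead, h₁, h₂, hσ.mixed i hone, j, hj, hi, hact⟩
    · exact hext (drain i) ⟨h, hhead, h₁, h₂, by omega, by omega, j, hj, hi, hact⟩
  -- the dual solution
  obtain ⟨w, hw⟩ : ∃ w, w + c₀ = a + 1 := ⟨a + 1 - c₀, by omega⟩
  obtain ⟨Y, hYdef⟩ : ∃ Y, Y = max c (a + 1) := ⟨_, rfl⟩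
  obtain ⟨g, hg⟩ : ∃ g, a + 1 + g = Y := ⟨Y - (a + 1), by omega⟩
  let z : J → ℕ := fun j =>
    w * (if j ∈ JH ∧ Active σ (heavySet l) j then 1 else 0) +
      if j ∈ JHᶜ ∧ ∀ k ∈ Mach j, k ∈ lightSet l ∨ σ j = some k then 1 else 0
  let y : M → ℕ := fun i =>
    if i ∈ lightSet l then Y
    else #(stuck JH Mach σ (lightSet l) i) + if i ∈ swapSet l then w else 0
  have hz : ∀ C : Finset J, ∑ j ∈ C, z j = w * #{j ∈ C | j ∈ JH ∧ Active σ (heavySet l) j} +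
      #{j ∈ C | j ∈ JHᶜ ∧ ∀ k ∈ Mach j, k ∈ lightSet l ∨ σ j = some k} := by
    intro C
    simp only [z, sum_add_distrib, ← mul_sum, sum_boole, Nat.cast_id]
  have hconf : ∀ i C, IsConfig JH Mach c c₀ i C → ∑ j ∈ C, z j ≤ y i := by
    intro i C hC
    rw [hz]
    set p := #{j ∈ C | j ∈ JH ∧ Active σ (heavySet l) j} with hp
    set q := #{j ∈ C | j ∈ JHᶜ ∧ ∀ k ∈ Mach j, k ∈ lightSet l ∨ σ j = some k} with hq
    have hp' : p ≤ #{j ∈ C | j ∈ JH} :=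
      card_le_card (monotone_filter_right _ fun _ _ h => h.1)
    have hq' : q ≤ #{j ∈ C | j ∈ JHᶜ} :=
      card_le_card (monotone_filter_right _ fun _ _ h => h.1)
    have hC₁ := hC.heavy_le
    have hC₂ := hC.light_le
    have hC₃ := hC.mixed
    have hpq : (p = 0 ∧ q ≤ c) ∨ (p = 1 ∧ q ≤ c₀) := by omega
    by_cases hi : i ∈ lightSet l
    · simp only [y, hi, if_true]
      rcases hpq with ⟨h₁, h₂⟩ | ⟨h₁, h₂⟩ <;> rw [h₁] <;> omega
    · simp only [y, hi, if_false]
      have hqs : q ≤ #(stuck JH Mach σ (lightSet l) i) := by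
        refine card_le_card fun j hj => ?_
        simp only [mem_filter, stuck] at hj ⊢
        exact ⟨hj.2.1, (hj.2.2 i (hC.mem j hj.1)).resolve_left hi, hj.2.2⟩
      rcases hpq with ⟨h₁, h₂⟩ | ⟨h₁, h₂⟩
      · rw [h₁]; omega
      · rw [h₁]
        by_cases his : i ∈ swapSet l
        · simp only [his, if_true]; omega
        · obtain ⟨j, hj⟩ := card_pos.mp (show 0 < p by omega)
          simp only [mem_filter] at hj
          have := hheavy j hj.2.1 hj.2.2 i (hC.mem j hj.1) hi his
          omega
  have hV : ∀ i, #(stuck JH Mach σ (lightSet l) i) +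
      (if i ∈ heavySet l then w * placedCount JH σ i else 0) ≤ ∑ j with σ j = some i, z j := by
    intro i
    rw [hz, add_comm]
    refine add_le_add ?_ (card_le_card fun j hj => ?_)
    · split_ifs with hi
      · refine Nat.mul_le_mul_left _ (card_le_card fun j hj => ?_)
        simp only [mem_filter, mem_univ, true_and] at hj ⊢
        refine ⟨hj.2, hj.1, fun i' hi' => ?_⟩
        rw [hj.2] at hi'
        exact Option.some.inj hi' ▸ hi
      · exact Nat.zero_le _
    · simp only [mem_filter, stuck, mem_univ, true_and] at hj ⊢
      exact ⟨hj.2.1, hj.1, hj.2.2⟩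
  have hlight := (card_lightSet_mul_le h (fun i => ∑ j with σ j = some i, z j) Y g
    (fun i hi => by
      obtain ⟨l', hs⟩ := suffix_of_mem _ hi
      have hiL : i ∈ lightSet l := lightSet_mono hs (by simp [lightSet])
      have hiH : i ∈ heavySet l := by
        obtain ⟨t, rfl⟩ := hs
        clear * -
        induction t with
        | nil => simp [heavySet]
        | cons e t ih => exact heavySet_subset_cons e _ ih
      have h₁ := hV i
      have h₂ := hstuck i hiL
      rw [if_pos hiH] at h₁
      rcases hfull i hi with ⟨h₃, h₄⟩ | h₃
      · rw [h₃] at h₁; omega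
      · omega)
    (fun i hi => by
      obtain ⟨l', hs⟩ := suffix_of_mem _ hi
      have hiL : i ∈ lightSet l := lightSet_mono hs (by simp [lightSet])
      have h₁ := hV i
      have h₂ := hstuck i hiL
      have h₃ := hdrain i hi
      omega)).2 hhead
  have hyV : ∑ i, y i ≤ ∑ i, ∑ j with σ j = some i, z j := by
    rw [← sum_add_sum_compl (lightSet l) y, ← sum_add_sum_compl (lightSet l) fun i =>
      ∑ j with σ j = some i, z j]
    refine add_le_add ?_ (sum_le_sum fun i hi => ?_)
    · rw [sum_congr rfl (g := fun _ => Y) fun i hi => by simp only [y, hi, if_true]]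
      simpa using hlight
    · rw [mem_compl] at hi
      have h₁ := hV i
      simp only [y, hi, if_false]
      split_ifs with his
      · rw [if_pos (swapSet_subset_heavySet l his), hswap i his] at h₁
        omega
      · omega
  have hpos : 0 < ∑ j ∈ unplaced σ, z j := by
    obtain ⟨j, hj⟩ := hun
    refine sum_pos' (fun _ _ => Nat.zero_le _) ⟨j, hj, ?_⟩
    have hnone : σ j = none := by simpa [unplaced] using hj
    have hact : ∀ S, Active σ S j := fun S i hi => by simp [hnone] at hi
    by_cases hjH : j ∈ JH
    · simp only [z, hjH, hact, and_self, if_true]; omega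
    · have := hclosed j hjH (hact _)
      have : ∀ k ∈ Mach j, k ∈ lightSet l ∨ σ j = some k := fun k hk => Or.inl (this hk)
      simp only [z, mem_compl, hjH, not_false_eq_true, true_and]
      rw [if_pos this]; omega
  have hzy := hdual (fun j => z j) (fun i => y i) fun i C hC => by exact_mod_cast hconf i C hC
  have : ∑ j, z j ≤ ∑ i, y i := by exact_mod_cast hzy
  rw [sum_eq_sum_placed_add_sum_unplaced σ z] at this
  omega

theorem exists_total_feasible [Fintype M] {c c₀ : ℕ} (hc₀ : c₀ ≤ a) (hab : a < b)
    (hc : 2 * c + c₀ ≤ 3 * a + 2) (hcb : 2 * c ≤ a + b + 1)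
    (hdual : DualBounded (IsConfig JH Mach c c₀)) :
    ∃ σ : J → M, Feasible JH Mach a b fun j => some (σ j) := by
  have hne : ∃ σ : J → Option M, Feasible JH Mach a b σ :=
    ⟨fun _ => none, by simp, by simp [placedCount], by simp [placedCount], by simp [placedCount]⟩
  obtain ⟨σ, hσ, hopt⟩ := Set.exists_min_image {σ : J → Option M | Feasible JH Mach a b σ}
    (fun σ => #(unplaced σ)) (Set.toFinite _) hne
  by_cases hun : (unplaced σ).Nonempty
  · refine (false_of_trace_progress
      (fun σ' l => Feasible JH Mach a b σ' ∧ unplaced σ' = unplaced σ ∧ Trace JH Mach a σ' l)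
      (blockerValue JH) _ (fun _ _ h => h.2.2.length_le) ?_ σ ⟨hσ, rfl, trivial⟩).elim
    rintro σ' l ⟨h₁, h₂, h₃⟩
    rcases trace_extendable_or_improvable hc₀ hab hc hcb h₁ (h₂ ▸ hopt) (h₂ ▸ hun) hdual h₃ with
      ⟨e, he⟩ | h
    · exact Or.inl ⟨e, h₁, h₂, he⟩
    · rw [← h₂]; exact Or.inr h
  · have htot : ∀ j, ∃ i, σ j = some i := by
      intro j
      rw [← Option.ne_none_iff_exists']
      intro hj
      exact hun ⟨j, by simp [unplaced, hj]⟩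
    choose τ hτ using htot
    exact ⟨τ, by rwa [← funext hτ]⟩

end Step

section Rounding

variable {Mach : J → Finset M} {p : J → ℝ} {T P : ℝ} {σ : J → Option M}

/-- The total size of the jobs that the partial schedule `σ` places on `i`. -/
def placedLoad (p : J → ℝ) (σ : J → Option M) (i : M) : ℝ := ∑ j with σ j = some i, p j

/-- Partial schedules whose loads are at most `B`. -/
structure LoadFeasible (Mach : J → Finset M) (p : J → ℝ) (B : ℝ) (σ : J → Option M) : Prop where
  mem : ∀ j i, σ j = some i → i ∈ Mach j
  load_le : ∀ i, placedLoad p σ i ≤ B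

/-- Sequences of machines, newest first, each of which can process an active job. -/
def MachineTrace (Mach : J → Finset M) (σ : J → Option M) : List M → Prop
  | [] => True
  | i :: l => MachineTrace Mach σ l ∧ i ∉ l ∧ ∃ j, i ∈ Mach j ∧ Active σ l.toFinset j

omit [Fintype J] in
theorem MachineTrace.nodup {l : List M} (h : MachineTrace Mach σ l) : l.Nodup := by
  induction l with
  | nil => exact List.nodup_nil
  | cons i l ih => exact List.nodup_cons.mpr ⟨h.2.1, ih h.1⟩

omit [Fintype J] in
theorem MachineTrace.suffix {l' l : List M} (hs : l' <:+ l) (h : MachineTrace Mach σ l) :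
    MachineTrace Mach σ l' := by
  obtain ⟨t, rfl⟩ := hs
  induction t with
  | nil => exact h
  | cons e t ih => exact ih h.1

omit [Fintype J] in
theorem MachineTrace.update {l : List M} (h : MachineTrace Mach σ l) {j : J}
    (hact : ¬ Active σ l.tail.toFinset j) (i : M) :
    MachineTrace Mach (Function.update σ j (some i)) l := by
  induction l with
  | nil => trivial
  | cons k l ih =>
    refine ⟨ih h.1 fun hc => hact (hc.mono fun x hx => ?_), h.2.1, ?_⟩
    · exact List.mem_toFinset.mpr (List.mem_of_mem_tail (List.mem_toFinset.mp hx))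
    · obtain ⟨x, hx, hxa⟩ := h.2.2
      exact ⟨x, hx, hxa.update (by rintro rfl; exact hact hxa) _⟩

theorem LoadFeasible.update (hp : ∀ j, 0 < p j) (hσ : LoadFeasible Mach p (T + P) σ) {j : J}
    (hj : p j ≤ P) {i : M} (hi : i ∈ Mach j) (hT : placedLoad p σ i ≤ T) :
    LoadFeasible Mach p (T + P) (Function.update σ j (some i)) where
  mem x k hx := by
    rcases eq_or_ne x j with rfl | hne
    · obtain rfl : i = k := by simpa using hx
      exact hi
    · exact hσ.mem x k (by simpa [hne] using hx)
  load_le k := by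
    rcases eq_or_ne k i with rfl | hne
    · have hsub : ({x | Function.update σ j (some k) x = some k} : Finset J) ⊆
          insert j ({x | σ x = some k} : Finset J) := by
        intro x hx
        rcases eq_or_ne x j with rfl | hne
        · simp
        · simpa [hne] using hx
      calc placedLoad p (Function.update σ j (some k)) k
          ≤ ∑ x ∈ insert j ({x | σ x = some k} : Finset J), p x :=
            sum_le_sum_of_subset_of_nonneg hsub fun x _ _ => (hp x).le
        _ ≤ placedLoad p σ k + p j := by
            by_cases hjk : j ∈ ({x | σ x = some k} : Finset J)
            · rw [insert_eq_of_mem hjk]; exact le_add_of_nonneg_right (hp j).le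
            · rw [sum_insert hjk, add_comm]; rfl
        _ ≤ T + P := add_le_add hT hj
    · exact (sum_le_sum_of_subset_of_nonneg (filter_update_subset univ σ j hne)
        fun x _ _ => (hp x).le).trans (hσ.load_le k)

/-- Machine configurations of total size at most `T`. -/
structure IsSizeConfig (Mach : J → Finset M) (p : J → ℝ) (T : ℝ) (i : M) (C : Finset J) :
    Prop where
  mem : ∀ j ∈ C, i ∈ Mach j
  size_le : ∑ j ∈ C, p j ≤ T

theorem machineTrace_extendable_or_improvable [Fintype M] {l : List M}
    (hp : ∀ j, 0 < p j) (hP : ∀ j, p j ≤ P) (hσ : LoadFeasible Mach p (T + P) σ)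
    (hopt : ∀ σ', LoadFeasible Mach p (T + P) σ' → #(unplaced σ) ≤ #(unplaced σ'))
    (hun : (unplaced σ).Nonempty) (hdual : DualBounded (IsSizeConfig Mach p T))
    (h : MachineTrace Mach σ l) :
    (∃ i, MachineTrace Mach σ (i :: l)) ∨ ∃ σ' k l', k :: l' <:+ l ∧
      (LoadFeasible Mach p (T + P) σ' ∧ unplaced σ' = unplaced σ ∧
        MachineTrace Mach σ' (k :: l')) ∧
      placedCount univ σ' k < placedCount univ σ k ∧
      ∀ x ∈ l', placedCount univ σ' x ≤ placedCount univ σ x := by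
  by_contra! hcon
  obtain ⟨hext, himp⟩ := hcon
  have hclosed : ∀ j, Active σ l.toFinset j → ∀ i ∈ Mach j, i ∈ l := by
    intro j hact i hi
    by_contra hil
    exact hext i ⟨h, hil, j, hi, hact⟩
  have hload : ∀ i ∈ l, T < placedLoad p σ i := by
    intro i hil
    obtain ⟨s, t, rfl⟩ := List.append_of_mem hil
    obtain ⟨ht, hit, j, hij, hact⟩ := h.suffix (List.suffix_append s _)
    by_contra! hle
    have hfeas := hσ.update hp (hP j) hij hle
    rcases hjk : σ j with _ | k
    · exact absurd (hopt _ hfeas) (not_le.mpr (card_unplaced_update_lt hjk i))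
    have hkt : k ∈ t := List.mem_toFinset.mp (hact k hjk)
    obtain ⟨t₁, t₂, htt⟩ : ∃ t₁ t₂, t = t₁ ++ k :: t₂ := List.append_of_mem hkt
    have hs : k :: t₂ <:+ t := htt ▸ List.suffix_append t₁ _
    have hs' : k :: t₂ <:+ s ++ i :: t :=
      hs.trans ((List.suffix_cons i t).trans (List.suffix_append s _))
    have htr := h.suffix hs'
    have hne : k ≠ i := by rintro rfl; exact hit hkt
    obtain ⟨x, hx, hlt⟩ := himp _ k t₂ hs'
      ⟨hfeas, unplaced_update (by simp [hjk]) i, htr.update (fun hc =>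
        (List.nodup_cons.mp htr.nodup).1 (List.mem_toFinset.mp (hc k hjk))) i⟩
      (placedCount_update_lt (mem_univ j) hne hjk)
    refine absurd hlt (not_lt.mpr (placedCount_update_le _ σ j ?_))
    rintro rfl
    exact hit (hs.subset (List.mem_cons_of_mem _ hx))
  let z : J → ℝ := fun j => if Active σ l.toFinset j then p j else 0
  let y : M → ℝ := fun i => if i ∈ l then T else 0
  have hz₀ : ∀ j, 0 ≤ z j := fun j => by
    simp only [z]; split_ifs
    · exact (hp j).le
    · exact le_rfl
  have hzp : ∀ j, z j ≤ p j := fun j => by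
    simp only [z]; split_ifs
    · exact le_rfl
    · exact (hp j).le
  have hzy := hdual z y fun i C hC => by
    by_cases hi : i ∈ l
    · simp only [y, hi, if_true]
      exact (sum_le_sum fun j _ => hzp j).trans hC.size_le
    · simp only [y, hi, if_false]
      refine (sum_eq_zero fun j hj => if_neg fun hact => hi ?_).le
      exact hclosed j hact i (hC.mem j hj)
  have hyV : ∑ i, y i ≤ ∑ i, ∑ j with σ j = some i, z j := by
    refine sum_le_sum fun i _ => ?_
    by_cases hi : i ∈ l
    · simp only [y, hi, if_true]
      refine (hload i hi).le.trans (sum_le_sum fun j hj => ?_)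
      have hact : Active σ l.toFinset j := fun k hk => by
        rw [(mem_filter.mp hj).2] at hk
        exact List.mem_toFinset.mpr (Option.some.inj hk ▸ hi)
      simp [z, hact]
    · simp only [y, hi, if_false]
      exact sum_nonneg fun j _ => hz₀ j
  have hpos : 0 < ∑ j ∈ unplaced σ, z j := by
    refine sum_pos (fun j hj => ?_) hun
    have hnone : σ j = none := by simpa [unplaced] using hj
    have hact : Active σ l.toFinset j := fun S hS => by simp [hnone] at hS
    simp [z, hact, hp j]
  rw [sum_eq_sum_placed_add_sum_unplaced σ z] at hzy
  linarith

/-- A schedule that exceeds the configuration bound by at most the largest job size. -/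
theorem exists_schedule_load_le_add [Fintype M] (hp : ∀ j, 0 < p j) (hP : ∀ j, p j ≤ P)
    (hTP : 0 ≤ T + P) (hdual : DualBounded (IsSizeConfig Mach p T)) :
    ∃ σ : J → M, LoadFeasible Mach p (T + P) fun j => some (σ j) := by
  have hne : ∃ σ : J → Option M, LoadFeasible Mach p (T + P) σ :=
    ⟨fun _ => none, by simp, by simpa [placedLoad] using fun _ => hTP⟩
  obtain ⟨σ, hσ, hopt⟩ := Set.exists_min_image
    {σ : J → Option M | LoadFeasible Mach p (T + P) σ}
    (fun σ => #(unplaced σ)) (Set.toFinite _) hne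
  by_cases hun : (unplaced σ).Nonempty
  · refine (false_of_trace_progress
      (fun σ' l => LoadFeasible Mach p (T + P) σ' ∧ unplaced σ' = unplaced σ ∧
        MachineTrace Mach σ' l)
      (placedCount univ) _ (fun _ _ h => h.2.2.nodup.length_le_card) ?_ σ ⟨hσ, rfl, trivial⟩).elim
    rintro σ' l ⟨h₁, h₂, h₃⟩
    rcases machineTrace_extendable_or_improvable hp hP h₁ (h₂ ▸ hopt) (h₂ ▸ hun) hdual h₃ with
      ⟨e, he⟩ | h
    · exact Or.inl ⟨e, h₁, h₂, he⟩
    · rw [← h₂]; exact Or.inr h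
  · have htot : ∀ j, ∃ i, σ j = some i := by
      intro j
      rw [← Option.ne_none_iff_exists']
      intro hj
      exact hun ⟨j, by simp [unplaced, hj]⟩
    choose τ hτ using htot
    exact ⟨τ, by rwa [← funext hτ]⟩

end Rounding

end LocalSearch

/-- Weak duality for the configuration LP. -/
theorem ConfLPFeasible.dualBounded {M J : Type*} [Fintype M] [Fintype J] [DecidableEq M]
    [DecidableEq J] {JH : Finset J} {ε T : ℝ} {Mach : J → Finset M}
    (h : ConfLPFeasible JH ε Mach T) {conf : M → Finset J → Prop}
    (hconf : ∀ i C, (∀ j ∈ C, i ∈ Mach j) → ∑ j ∈ C, jobSize JH ε j ≤ T → conf i C) :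
    DualBounded conf := by
  obtain ⟨x, hx₀, hx, hx₁, hxj⟩ := h
  intro z y hzy
  calc ∑ j, z j = ∑ j, ∑ i, ∑ C : Finset J, if j ∈ C then x i C * z j else 0 := by
        refine sum_congr rfl fun j _ => ?_
        conv_lhs => rw [← one_mul (z j), ← hxj j, sum_mul]
        refine sum_congr rfl fun i _ => ?_
        rw [sum_mul, sum_filter]
    _ = ∑ i, ∑ C : Finset J, x i C * ∑ j ∈ C, z j := by
        rw [sum_comm]
        refine sum_congr rfl fun i _ => ?_
        rw [sum_comm]
        refine sum_congr rfl fun C _ => ?_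
        rw [mul_sum, ← sum_filter]
        simp
    _ ≤ ∑ i, ∑ C : Finset J, x i C * y i := by
        refine sum_le_sum fun i _ => sum_le_sum fun C _ => ?_
        by_cases h₀ : x i C = 0
        · simp [h₀]
        · exact mul_le_mul_of_nonneg_left (hzy i C (hconf i C (hx i C h₀).1 (hx i C h₀).2))
            (hx₀ i C)
    _ = ∑ i, y i := by
        refine sum_congr rfl fun i _ => ?_
        rw [← sum_mul, hx₁ i, one_mul]

theorem sum_jobSize {J : Type*} [Fintype J] (JH : Finset J) (ε : ℝ) (C : Finset J) :
    ∑ j ∈ C, jobSize JH ε j = #{j ∈ C | j ∈ JH} + #{j ∈ C | j ∈ JHᶜ} * ε := by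
  simp only [jobSize, sum_ite, sum_const, nsmul_eq_mul, mul_one, mem_compl]

/-- **Main result (existential content).** There is a constant `δ* > 0` such that every
`(1,ε)`-restricted assignment instance admits a schedule of makespan at most
`(2 - δ*) · OPT_f`, where `OPT_f` is the smallest `T ≥ 1` for which the configuration LP
is feasible. -/
theorem main_result_one_eps_restricted_assignment :
    ∃ δstar : ℝ, 0 < δstar ∧
      ∀ (M J : Type) [Fintype M] [Fintype J] [DecidableEq M] [DecidableEq J]
        (JH : Finset J) (ε : ℝ) (Mach : J → Finset M) (OPTf : ℝ),
        0 < ε → ε < 1 →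
        (∀ j, (Mach j).Nonempty) →
        1 ≤ OPTf →
        ConfLPFeasible JH ε Mach OPTf →
        (∀ T : ℝ, 1 ≤ T → ConfLPFeasible JH ε Mach T → OPTf ≤ T) →
        ∃ σ : J → M, (∀ j, σ j ∈ Mach j) ∧
          ∀ i, machineLoad JH ε σ i ≤ (2 - δstar) * OPTf := by
  refine ⟨1 / 6, by norm_num, ?_⟩
  intro M J _ _ _ instJ
  obtain rfl : instJ = fun a b => Classical.propDecidable (a = b) := Subsingleton.elim _ _
  intro JH ε Mach T hε hε₁ _ hT hLP _
  by_cases hT₂ : 2 ≤ T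
  · have hdual : DualBounded (IsSizeConfig Mach (jobSize JH ε) T) :=
      hLP.dualBounded fun i C h₁ h₂ => ⟨h₁, h₂⟩
    obtain ⟨σ, hσ⟩ := exists_schedule_load_le_add (P := 1)
      (fun j => by unfold jobSize; split_ifs <;> linarith)
      (fun j => by unfold jobSize; split_ifs <;> linarith) (by linarith) hdual
    refine ⟨σ, fun j => hσ.mem j _ rfl, fun i => ?_⟩
    have h := hσ.load_le i
    simp only [placedLoad, Option.some.injEq] at h
    have : machineLoad JH ε σ i ≤ T + 1 := by
      unfold machineLoad
      convert h
    linarith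
  · push Not at hT₂
    have hA : 0 ≤ (11 / 6 * T - 1) / ε := div_nonneg (by linarith) hε.le
    have hB : 0 ≤ 11 / 6 * T / ε := div_nonneg (by linarith) hε.le
    have hC : 0 ≤ T / ε := div_nonneg (by linarith) hε.le
    have hD : 0 ≤ (T - 1) / ε := div_nonneg (by linarith) hε.le
    set a := ⌊(11 / 6 * T - 1) / ε⌋₊ with ha
    set b := ⌊11 / 6 * T / ε⌋₊ with hb
    set c := ⌊T / ε⌋₊ with hc
    set d := ⌊(T - 1) / ε⌋₊ with hd
    have ha₁ : a * ε ≤ 11 / 6 * T - 1 := (le_div_iff₀ hε).mp (Nat.floor_le hA)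
    have ha₂ : 11 / 6 * T - 1 < (a + 1) * ε := (div_lt_iff₀ hε).mp (Nat.lt_floor_add_one _)
    have hb₁ : b * ε ≤ 11 / 6 * T := (le_div_iff₀ hε).mp (Nat.floor_le hB)
    have hb₂ : 11 / 6 * T < (b + 1) * ε := (div_lt_iff₀ hε).mp (Nat.lt_floor_add_one _)
    have hc₁ : c * ε ≤ T := (le_div_iff₀ hε).mp (Nat.floor_le hC)
    have hd₁ : d * ε ≤ T - 1 := (le_div_iff₀ hε).mp (Nat.floor_le hD)
    have key : ∀ m n : ℕ, (m : ℝ) * ε < n * ε → m < n := fun m n h => by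
      exact_mod_cast lt_of_mul_lt_mul_right h hε.le
    have hda : d ≤ a := Nat.lt_succ_iff.mp (key _ _ (by push_cast; linarith))
    have hab : a < b := by
      have := key (a + 1) (b + 1) (by push_cast; linarith)
      omega
    have hcd : 2 * c + d ≤ 3 * a + 2 := by
      have := key (2 * c + d) (3 * (a + 1)) (by push_cast; linarith)
      omega
    have hcab : 2 * c ≤ a + b + 1 := by
      have := key (2 * c) ((a + 1) + (b + 1)) (by push_cast; linarith)
      omega
    have hdual : DualBounded (IsConfig JH Mach c d) := by
      refine hLP.dualBounded fun i C h₁ h₂ => ?_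
      rw [sum_jobSize] at h₂
      have hlight : (0 : ℝ) ≤ #{j ∈ C | j ∈ JHᶜ} * ε := by positivity
      have hheavy : (0 : ℝ) ≤ #{j ∈ C | j ∈ JH} := by positivity
      refine ⟨h₁, ?_, Nat.le_floor ((le_div_iff₀ hε).mpr (by linarith)), fun hone => ?_⟩
      · have : (#{j ∈ C | j ∈ JH} : ℝ) < 2 := by linarith
        have : #{j ∈ C | j ∈ JH} < 2 := by exact_mod_cast this
        omega
      · rw [hone, Nat.cast_one] at h₂
        exact Nat.le_floor ((le_div_iff₀ hε).mpr (by linarith))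
    obtain ⟨σ, hσ⟩ := exists_total_feasible hda hab hcd hcab hdual
    refine ⟨σ, fun j => hσ.mem j _ rfl, fun i => ?_⟩
    have hload : machineLoad JH ε σ i = placedCount JH (fun j => some (σ j)) i +
        placedCount JHᶜ (fun j => some (σ j)) i * ε := by
      rw [machineLoad, sum_jobSize]
      simp only [placedCount, Option.some.injEq]
      congr 3
      · ext j; simp [and_comm]
      · congr 1; ext j; simp [and_comm]
    have h₁ := hσ.heavy_le i
    rw [hload]
    rcases Nat.le_one_iff_eq_zero_or_eq_one.mp h₁ with h | h
    · have h₂ : (placedCount JHᶜ (fun j => some (σ j)) i : ℝ) * ε ≤ b * ε :=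
        mul_le_mul_of_nonneg_right (by exact_mod_cast hσ.light_le i) hε.le
      rw [h, Nat.cast_zero]
      linarith
    · have h₂ : (placedCount JHᶜ (fun j => some (σ j)) i : ℝ) * ε ≤ a * ε :=
        mul_le_mul_of_nonneg_right (by exact_mod_cast hσ.mixed i h) hε.le
      rw [h, Nat.cast_one]
      linarith
end
end

section
/- For a canonical instance, a valid assignment f of heavy jobs is δ-good if and only if for every subset S ⊆ M, |S ∩ f(J_H)| + w_{S,S} ≤ (2 − δ)·|S|. -/
open Finset

noncomputable section

open scoped Classical

/-- `wSum w S T = Σ_{h ∈ S, k ∈ T} w h k`. -/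
def wSum {M : Type*} (w : M → M → ℝ) (S T : Finset M) : ℝ :=
  ∑ h ∈ S, ∑ k ∈ T, w h k

/-- A canonical instance: pairwise-disjoint machine sets for the heavy jobs, a nonnegative
light-load matrix `w`, and `z : M → [0, 0.4]` with `z i = 0` iff `i` is in no `Mach j`. -/
def IsCanonical {M JH : Type*} (Mach : JH → Finset M) (w : M → M → ℝ) (z : M → ℝ) : Prop :=
  Pairwise (fun j j' : JH => Disjoint (Mach j) (Mach j')) ∧
  (∀ h k, 0 ≤ w h k) ∧
  (∀ h k, h ≠ k → z k = 0 → w h k = 0) ∧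
  (∀ h, 0 < z h → w h h = 0) ∧
  (∀ i, 0 ≤ z i ∧ z i ≤ 0.4) ∧
  (∀ i, z i = 0 ↔ ∀ j, i ∉ Mach j)

/-- A `(p, q, θ)`-canonical instance. -/
def IsPQCanonical {M JH : Type*} [Fintype M] (Mach : JH → Finset M) (w : M → M → ℝ)
    (z : M → ℝ) (p q θ : ℝ) : Prop :=
  IsCanonical Mach w z ∧
  1 ≤ p ∧ 1 ≤ q ∧ 0 ≤ θ ∧ θ < 0.2 ∧
  (∀ i, z i = 0 ∨ 1 / p ≤ z i) ∧
  (∀ h k, w h k = 0 ∨ 1 / q ≤ w h k) ∧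
  (∀ j, 0.2 - θ ≤ ∑ i ∈ Mach j, z i) ∧
  (∀ h, z h + (∑ k, w k h * (1 - z h)) + (∑ k, w h k * z k) ≤ 1 + θ)

/-- A valid assignment of heavy jobs. -/
def IsValid {M JH : Type*} (Mach : JH → Finset M) (f : JH → M) : Prop :=
  ∀ j, f j ∈ Mach j

/-- `f` is `δ`-good: the light loads can be fractionally assigned (each `w h k` split between
`h` and `k`, with `s h k` placed on `h` and the rest on `k`) so that every machine receives
total load (including 1 for a heavy job, if assigned one) at most `2 - δ`. -/
def IsGood {M JH : Type*} [Fintype M] [DecidableEq M] [Fintype JH]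
    (w : M → M → ℝ) (δ : ℝ) (f : JH → M) : Prop :=
  ∃ s : M → M → ℝ,
    (∀ h k, 0 ≤ s h k ∧ s h k ≤ w h k) ∧
    ∀ i : M,
      (if i ∈ Finset.univ.image f then (1 : ℝ) else 0) +
        (∑ k, s i k) + (∑ h, (w h i - s h i)) ≤ 2 - δ

/-- The light load received by machine `i` when `s h k` of each `w h k` is placed on `h` and the
rest on `k`. -/
def lightLoad {M : Type*} [Fintype M] (w s : M → M → ℝ) (i : M) : ℝ :=
  ∑ k, s i k + ∑ h, (w h i - s h i)

theorem wSum_le_sum_lightLoad {M : Type*} [Fintype M] {w s : M → M → ℝ}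
    (hs : ∀ h k, 0 ≤ s h k ∧ s h k ≤ w h k) (S : Finset M) :
    wSum w S S ≤ ∑ i ∈ S, lightLoad w s i := by
  have hsplit : wSum w S S = ∑ i ∈ S, (∑ k ∈ S, s i k + ∑ h ∈ S, (w h i - s h i)) := by
    rw [Finset.sum_add_distrib, Finset.sum_comm (f := fun i h => w h i - s h i),
      ← Finset.sum_add_distrib]
    refine Finset.sum_congr rfl fun i _ => ?_
    rw [← Finset.sum_add_distrib]
    exact Finset.sum_congr rfl fun k _ => by ring
  rw [hsplit]
  refine Finset.sum_le_sum fun i _ => add_le_add ?_ ?_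
  · exact Finset.sum_le_sum_of_subset_of_nonneg (Finset.subset_univ S) fun k _ _ => (hs i k).1
  · exact Finset.sum_le_sum_of_subset_of_nonneg (Finset.subset_univ S)
      fun h _ _ => sub_nonneg.2 (hs h i).2

theorem sum_lightLoad_eq_wSum {M : Type*} [Fintype M] {w s : M → M → ℝ} {S : Finset M}
    (hout : ∀ i ∈ S, ∀ k ∉ S, s i k = 0) (hin : ∀ i ∈ S, ∀ h ∉ S, s h i = w h i) :
    ∑ i ∈ S, lightLoad w s i = wSum w S S := by
  have hrestrict : ∀ i ∈ S,
      lightLoad w s i = ∑ k ∈ S, s i k + ∑ h ∈ S, (w h i - s h i) := by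
    intro i hi
    unfold lightLoad
    congr 1
    · exact (Finset.sum_subset (Finset.subset_univ S) fun k _ hk => hout i hi k hk).symm
    · exact (Finset.sum_subset (Finset.subset_univ S)
        fun h _ hh => by rw [hin i hi h hh, sub_self]).symm
  rw [Finset.sum_congr rfl hrestrict, Finset.sum_add_distrib,
    Finset.sum_comm (f := fun i h => w h i - s h i), ← Finset.sum_add_distrib]
  refine Finset.sum_congr rfl fun i _ => ?_
  rw [← Finset.sum_add_distrib]
  exact Finset.sum_congr rfl fun k _ => by ring

/-- Shifting an amount `d` of `w h k` from `k` to `h`. -/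
def shiftSplit {M : Type*} (s : M → M → ℝ) (h k : M) (d : ℝ) : M → M → ℝ :=
  fun i j => s i j + if i = h then (if j = k then d else 0) else 0

theorem lightLoad_shiftSplit {M : Type*} [Fintype M] (w s : M → M → ℝ) (h k : M) (d : ℝ) (i : M) :
    lightLoad w (shiftSplit s h k d) i =
      lightLoad w s i + d * ((if i = h then 1 else 0) - (if i = k then 1 else 0)) := by
  have hrow : ∑ j, (if i = h then (if j = k then d else 0) else 0) = if i = h then d else 0 := by
    split_ifs <;> simp
  have hcol : ∑ j, (if j = h then (if i = k then d else 0) else 0) = if i = k then d else 0 := by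
    simp
  simp only [lightLoad, shiftSplit, Finset.sum_add_distrib, Finset.sum_sub_distrib, hrow, hcol]
  split_ifs <;> ring

theorem sum_sq_lightLoad_shiftSplit_le {M : Type*} [Fintype M] (w s : M → M → ℝ) (c : M → ℝ)
    (h k : M) (d : ℝ) :
    ∑ i, (lightLoad w (shiftSplit s h k d) i - c i) ^ 2 ≤
      ∑ i, (lightLoad w s i - c i) ^ 2 +
        2 * (d * ((lightLoad w s h - c h) - (lightLoad w s k - c k)) + d ^ 2) := by
  have hterm : ∀ i, (lightLoad w (shiftSplit s h k d) i - c i) ^ 2 ≤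
      (lightLoad w s i - c i) ^ 2 +
        ((if i = h then 2 * d * (lightLoad w s i - c i) + d ^ 2 else 0) +
          (if i = k then -(2 * d * (lightLoad w s i - c i)) + d ^ 2 else 0)) := by
    intro i
    rw [lightLoad_shiftSplit]
    split_ifs <;> nlinarith [sq_nonneg d]
  refine (Finset.sum_le_sum fun i _ => hterm i).trans (le_of_eq ?_)
  simp only [Finset.sum_add_distrib, Finset.sum_ite_eq', Finset.mem_univ,
    if_true]
  ring

/-- If no set of machines carries more internal light load than its total capacity, the light
loads can be split within the capacities. A split minimizing the sum of squared excesses works: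
no load inside it can be moved from an overloaded machine to one that is not. -/
theorem exists_split_of_wSum_le {M : Type*} [Fintype M] {w : M → M → ℝ} (hw : ∀ h k, 0 ≤ w h k)
    {c : M → ℝ} (hc : ∀ S : Finset M, wSum w S S ≤ ∑ i ∈ S, c i) :
    ∃ s : M → M → ℝ, (∀ h k, 0 ≤ s h k ∧ s h k ≤ w h k) ∧ ∀ i, lightLoad w s i ≤ c i := by
  have hcont : Continuous fun s : M → M → ℝ => ∑ i, (lightLoad w s i - c i) ^ 2 := by
    unfold lightLoad
    fun_prop
  obtain ⟨s, hs, hmin⟩ := (isCompact_Icc (a := (0 : M → M → ℝ)) (b := w)).exists_isMinOn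
    ⟨0, le_rfl, hw⟩ hcont.continuousOn
  have hs' : ∀ h k, 0 ≤ s h k ∧ s h k ≤ w h k := fun h k => ⟨hs.1 h k, hs.2 h k⟩
  have hshift : ∀ h k d, 0 ≤ s h k + d → s h k + d ≤ w h k →
      0 ≤ d * ((lightLoad w s h - c h) - (lightLoad w s k - c k)) + d ^ 2 := by
    intro h k d h0 h1
    have hmem : ∀ i j, 0 ≤ shiftSplit s h k d i j ∧ shiftSplit s h k d i j ≤ w i j := by
      intro i j
      unfold shiftSplit
      split_ifs with hi hj
      · subst hi hj
        exact ⟨h0, h1⟩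
      all_goals simpa using hs' i j
    have hle := hmin (show shiftSplit s h k d ∈ Set.Icc 0 w from
      ⟨fun i j => (hmem i j).1, fun i j => (hmem i j).2⟩)
    have hle' : ∑ i, (lightLoad w s i - c i) ^ 2 ≤
        ∑ i, (lightLoad w (shiftSplit s h k d) i - c i) ^ 2 := hle
    linarith [sum_sq_lightLoad_shiftSplit_le w s c h k d]
  refine ⟨s, hs', ?_⟩
  by_contra! hex
  obtain ⟨m, hm⟩ := hex
  set S : Finset M := Finset.univ.filter fun i => c i < lightLoad w s i with hS
  have hmemS : ∀ i, i ∈ S ↔ c i < lightLoad w s i := fun i => by simp [hS]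
  have hgap : ∀ i ∈ S, ∀ k ∉ S, 0 < (lightLoad w s i - c i) - (lightLoad w s k - c k) := by
    intro i hi k hk
    rw [hmemS] at hi hk
    linarith
  have htot : ∑ i ∈ S, lightLoad w s i = wSum w S S := by
    apply sum_lightLoad_eq_wSum
    · intro i hi k hk
      by_contra hne
      have hpos : 0 < s i k := lt_of_le_of_ne (hs' i k).1 (Ne.symm hne)
      have hg := hgap i hi k hk
      obtain ⟨t, ht0, ht⟩ := exists_between (lt_min hpos hg)
      have ht1 := ht.trans_le (min_le_left _ _)
      have ht2 := ht.trans_le (min_le_right _ _)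
      have := hshift i k (-t) (by linarith) (by linarith [(hs' i k).2])
      nlinarith [mul_pos ht0 (sub_pos.2 ht2)]
    · intro i hi h hh
      by_contra hne
      have hpos : 0 < w h i - s h i := sub_pos.2 (lt_of_le_of_ne (hs' h i).2 hne)
      have hg := hgap i hi h hh
      obtain ⟨t, ht0, ht⟩ := exists_between (lt_min hpos hg)
      have ht1 := ht.trans_le (min_le_left _ _)
      have ht2 := ht.trans_le (min_le_right _ _)
      have := hshift h i t (by linarith [(hs' h i).1]) (by linarith)
      nlinarith [mul_pos ht0 (sub_pos.2 ht2)]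
  have hlt : ∑ i ∈ S, c i < ∑ i ∈ S, lightLoad w s i :=
    Finset.sum_lt_sum_of_nonempty ⟨m, (hmemS m).2 hm⟩ fun i hi => (hmemS i).1 hi
  linarith [hc S]

/-- **Characterization of δ-good assignments.** For a canonical instance, a valid assignment
`f` of heavy jobs is δ-good iff `|S ∩ f(J_H)| + w_{S,S} ≤ (2 - δ)|S|` for every `S ⊆ M`. -/
theorem good_iff_density
    (M JH : Type) [Fintype M] [DecidableEq M] [Fintype JH]
    (Mach : JH → Finset M) (w : M → M → ℝ) (z : M → ℝ) (δ : ℝ) (f : JH → M)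
    (hc : IsCanonical Mach w z) (hv : IsValid Mach f) :
    IsGood w δ f ↔
      ∀ S : Finset M,
        ((S ∩ Finset.univ.image f).card : ℝ) + wSum w S S ≤ (2 - δ) * (S.card : ℝ) := by
  have hcard : ∀ S : Finset M, ∑ i ∈ S, ((2 - δ) - if i ∈ Finset.univ.image f then (1 : ℝ) else 0)
      = (2 - δ) * (S.card : ℝ) - ((S ∩ Finset.univ.image f).card : ℝ) := by
    intro S
    rw [Finset.sum_sub_distrib, Finset.sum_const, nsmul_eq_mul, Finset.sum_boole,
      Finset.filter_mem_eq_inter, mul_comm]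
  constructor
  · rintro ⟨s, hs, hload⟩ S
    have hsum : ∑ i ∈ S, lightLoad w s i ≤
        ∑ i ∈ S, ((2 - δ) - if i ∈ Finset.univ.image f then (1 : ℝ) else 0) :=
      Finset.sum_le_sum fun i _ => by
        have := hload i
        unfold lightLoad
        linarith
    linarith [wSum_le_sum_lightLoad hs S, hcard S]
  · intro hdens
    obtain ⟨s, hs, hload⟩ := exists_split_of_wSum_le hc.2.1
      (c := fun i => (2 - δ) - if i ∈ Finset.univ.image f then (1 : ℝ) else 0)
      fun S => by linarith [hdens S, hcard S]
    refine ⟨s, hs, fun i => ?_⟩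
    have := hload i
    unfold lightLoad at this
    linarith
end
end

section
/- If (S,T) is a δ-witness of a canonical instance, then there exists a connected δ-witness (S̃, T̃) with S̃ ⊆ S and T̃ ⊆ T. -/
open Finset

noncomputable section

open scoped Classical

/-- A `δ`-witness: a pair `(S, T)` with `T ⊆ S` and `|T| + w_{S,S} > (2 - δ)|S|`. -/
def IsWitness {M : Type*} (w : M → M → ℝ) (δ : ℝ) (S T : Finset M) : Prop :=
  T ⊆ S ∧ (2 - δ) * (S.card : ℝ) < (T.card : ℝ) + wSum w S S

/-- The light load graph `G_w` (as an undirected graph capturing weak connectivity):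
`h` and `k` are adjacent iff `h ≠ k` and `w h k > 0` or `w k h > 0`. -/
def lightGraph {M : Type*} (w : M → M → ℝ) : SimpleGraph M :=
  SimpleGraph.fromRel (fun h k => 0 < w h k)

/-- A connected `δ`-witness: a `δ`-witness `(S, T)` such that `S` is weakly connected
in the light load graph `G_w`. -/
def IsConnectedWitness {M : Type*} (w : M → M → ℝ) (δ : ℝ) (S T : Finset M) : Prop :=
  IsWitness w δ S T ∧ (SimpleGraph.induce (↑S : Set M) (lightGraph w)).Connected

/-- If no light load runs between the disjoint sets `A` and `B`, the light loads add up. -/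
theorem wSum_union {M : Type*} {w : M → M → ℝ} {A B : Finset M} (hd : Disjoint A B)
    (h : ∀ x ∈ A, ∀ y ∈ B, w x y = 0 ∧ w y x = 0) :
    wSum w (A ∪ B) (A ∪ B) = wSum w A A + wSum w B B := by
  have hAB : ∑ x ∈ A, ∑ y ∈ B, w x y = 0 :=
    sum_eq_zero fun x hx => sum_eq_zero fun y hy => (h x hx y hy).1
  have hBA : ∑ y ∈ B, ∑ x ∈ A, w y x = 0 :=
    sum_eq_zero fun y hy => sum_eq_zero fun x hx => (h x hx y hy).2
  simp only [wSum, sum_union hd, sum_add_distrib, hAB, hBA]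
  ring

/-- A witness that splits into two parts with no light load between them restricts to a witness
on one of the parts. -/
theorem IsWitness.of_union {M : Type*} {w : M → M → ℝ} {δ : ℝ} {A B T : Finset M}
    (hd : Disjoint A B) (h : ∀ x ∈ A, ∀ y ∈ B, w x y = 0 ∧ w y x = 0)
    (hw : IsWitness w δ (A ∪ B) T) :
    IsWitness w δ A (T ∩ A) ∨ IsWitness w δ B (T ∩ B) := by
  obtain ⟨hT, hlt⟩ := hw
  by_contra! hne
  have hA := not_lt.mp fun hl => hne.1 ⟨inter_subset_right, hl⟩
  have hB := not_lt.mp fun hl => hne.2 ⟨inter_subset_right, hl⟩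
  have hcT : T.card = (T ∩ A).card + (T ∩ B).card := by
    rw [← card_union_of_disjoint (hd.mono inter_subset_right inter_subset_right),
      ← inter_union_distrib_left, inter_eq_left.mpr hT]
  rw [wSum_union hd h, card_union_of_disjoint hd, hcT] at hlt
  push_cast at hlt
  linarith

/-- A nonempty finite set that is not connected in `G` splits into two nonempty parts
with no edge between them. -/
theorem exists_split_of_not_connected {M : Type*} (G : SimpleGraph M) {S : Finset M}
    (hS : S.Nonempty) (hG : ¬ (SimpleGraph.induce (↑S : Set M) G).Connected) :
    ∃ A B : Finset M, A.Nonempty ∧ B.Nonempty ∧ Disjoint A B ∧ A ∪ B = S ∧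
      ∀ x ∈ A, ∀ y ∈ B, ¬ G.Adj x y := by
  have : Nonempty (↑S : Set M) := hS.to_subtype
  rw [SimpleGraph.connected_iff, and_iff_left this, SimpleGraph.Preconnected] at hG
  push Not at hG
  obtain ⟨a, b, hab⟩ := hG
  let P : M → Prop := fun x =>
    ∃ hx : x ∈ (↑S : Set M), (SimpleGraph.induce (↑S : Set M) G).Reachable a ⟨x, hx⟩
  refine ⟨S.filter P, S.filter (fun x => ¬ P x), ⟨a, ?_⟩, ⟨b, ?_⟩,
    disjoint_filter_filter_not _ _ _, filter_union_filter_not_eq _ _, ?_⟩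
  · exact mem_filter.mpr ⟨a.2, a.2, SimpleGraph.Reachable.refl _⟩
  · exact mem_filter.mpr ⟨b.2, fun ⟨_, hr⟩ => hab hr⟩
  · intro x hx y hy hadj
    obtain ⟨hxS, hxS', hr⟩ := mem_filter.mp hx
    obtain ⟨hyS, hyP⟩ := mem_filter.mp hy
    have hadj' : (SimpleGraph.induce (↑S : Set M) G).Adj ⟨x, hxS⟩ ⟨y, hyS⟩ := hadj
    exact hyP ⟨hyS, hr.trans hadj'.reachable⟩

/-- For nonnegative light loads, every witness contains a connected one. -/
theorem IsWitness.exists_connected {M : Type*} {w : M → M → ℝ} {δ : ℝ}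
    (h0 : ∀ h k, 0 ≤ w h k) (S T : Finset M) (hw : IsWitness w δ S T) :
    ∃ S' T' : Finset M, S' ⊆ S ∧ T' ⊆ T ∧ IsConnectedWitness w δ S' T' := by
  induction S using Finset.strongInduction generalizing T with
  | H S ih =>
    by_cases hG : (SimpleGraph.induce (↑S : Set M) (lightGraph w)).Connected
    · exact ⟨S, T, Subset.rfl, Subset.rfl, hw, hG⟩
    have hS : S.Nonempty := by
      rw [nonempty_iff_ne_empty]
      rintro rfl
      obtain ⟨hT, hlt⟩ := hw
      simp [subset_empty.mp hT, wSum] at hlt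
    obtain ⟨A, B, hA, hB, hd, rfl, hadj⟩ := exists_split_of_not_connected _ hS hG
    have hzero : ∀ x ∈ A, ∀ y ∈ B, w x y = 0 ∧ w y x = 0 := by
      intro x hx y hy
      have hn := hadj x hx y hy
      have hxy : x ≠ y := fun e => disjoint_left.mp hd hx (e ▸ hy)
      simp only [lightGraph, SimpleGraph.fromRel_adj, not_and_or, not_or, not_lt] at hn
      obtain hn | ⟨h1, h2⟩ := hn
      · exact absurd hxy hn
      · exact ⟨h1.antisymm (h0 _ _), h2.antisymm (h0 _ _)⟩
    have hlA : A ⊂ A ∪ B := by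
      obtain ⟨b, hb⟩ := hB
      exact Finset.ssubset_iff_subset_ne.mpr ⟨subset_union_left, fun e =>
        disjoint_left.mp hd (e.superset (mem_union_right A hb)) hb⟩
    have hlB : B ⊂ A ∪ B := by
      obtain ⟨a, ha⟩ := hA
      exact Finset.ssubset_iff_subset_ne.mpr ⟨subset_union_right, fun e =>
        disjoint_left.mp hd ha (e.superset (mem_union_left B ha))⟩
    obtain hw' | hw' := hw.of_union hd hzero
    · obtain ⟨S', T', hS', hT', hc⟩ := ih A hlA _ hw'
      exact ⟨S', T', hS'.trans hlA.subset, hT'.trans inter_subset_left, hc⟩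
    · obtain ⟨S', T', hS', hT', hc⟩ := ih B hlB _ hw'
      exact ⟨S', T', hS'.trans hlB.subset, hT'.trans inter_subset_left, hc⟩

/-- If `(S, T)` is a δ-witness of a canonical instance, then there is a connected δ-witness
`(S', T')` with `S' ⊆ S` and `T' ⊆ T`. -/
theorem witness_implies_connected_witness
    (M JH : Type) [Fintype M] [DecidableEq M] [Fintype JH]
    (Mach : JH → Finset M) (w : M → M → ℝ) (z : M → ℝ) (δ : ℝ)
    (hc : IsCanonical Mach w z)
    (S T : Finset M) (hw : IsWitness w δ S T) :
    ∃ S' T' : Finset M, S' ⊆ S ∧ T' ⊆ T ∧ IsConnectedWitness w δ S' T' :=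
  hw.exists_connected hc.2.1
end
end

section
/- For any (p,q,θ)-canonical instance with θ ≤ 0.05, every machine h ∈ M satisfies w_{M,h} ≤ 1.1 and w_{h,M} ≤ 1.1·p, where w_{M,h} = Σ_{k∈M} w_{k,h} and w_{h,M} = Σ_{k∈M} w_{h,k}. -/
open Finset

noncomputable section

open scoped Classical

/-- Each outgoing light load of `h` is at most `p` times its contribution to the load of `h`. -/
theorem IsPQCanonical.light_load_le {M JH : Type*} [Fintype M] {Mach : JH → Finset M}
    {w : M → M → ℝ} {z : M → ℝ} {p q θ : ℝ} (hc : IsPQCanonical Mach w z p q θ) (h k : M) :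
    w h k ≤ p * (w k h * (1 - z h) + w h k * z k) := by
  obtain ⟨⟨-, hw, hoff, -, hz, -⟩, hp, -, -, -, hzp, -, -, -⟩ := hc
  have hp0 : 0 < p := by linarith
  have hin : 0 ≤ w k h * (1 - z h) := mul_nonneg (hw k h) (by linarith [(hz h).2])
  rcases hzp k with hk | hk
  · by_cases hkh : h = k
    · subst hkh
      simpa [hk] using le_mul_of_one_le_left (hw h h) hp
    · rw [hoff h k hkh hk, zero_mul, add_zero]
      exact mul_nonneg hp0.le hin
  · have hpz : 1 ≤ p * z k := by rwa [div_le_iff₀' hp0] at hk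
    nlinarith [mul_le_mul_of_nonneg_left hpz (hw h k), mul_nonneg hp0.le hin]

/-- For any `(p, q, θ)`-canonical instance with `θ ≤ 0.05`, every machine `h` has
incoming light load `w_{M,h} ≤ 1.1` and outgoing light load `w_{h,M} ≤ 1.1·p`. -/
theorem degree_is_small
    (M JH : Type) [Fintype M] [DecidableEq M] [Fintype JH]
    (Mach : JH → Finset M) (w : M → M → ℝ) (z : M → ℝ) (p q θ : ℝ)
    (hc : IsPQCanonical Mach w z p q θ) (hθ : θ ≤ 0.05) :
    ∀ h : M, (∑ k, w k h) ≤ 1.1 ∧ (∑ k, w h k) ≤ 1.1 * p := by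
  intro h
  have hload := hc.2.2.2.2.2.2.2.2 h
  have hzh := hc.1.2.2.2.2.1 h
  have hp := hc.2.1
  have hw := hc.1.2.1
  constructor
  · have hout : 0 ≤ ∑ k, w h k * z k :=
      Finset.sum_nonneg fun k _ => mul_nonneg (hw h k) (hc.1.2.2.2.2.1 k).1
    rw [← Finset.sum_mul] at hload
    norm_num at hzh hθ ⊢
    by_contra! hlt
    nlinarith
  · calc ∑ k, w h k ≤ ∑ k, p * (w k h * (1 - z h) + w h k * z k) :=
          Finset.sum_le_sum fun k _ => hc.light_load_le h k
      _ = p * (∑ k, w k h * (1 - z h) + ∑ k, w h k * z k) := by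
          rw [← Finset.mul_sum, Finset.sum_add_distrib]
      _ ≤ p * 1.1 := by
          gcongr
          norm_num at hθ ⊢
          linarith
      _ = 1.1 * p := mul_comm _ _
end
end

section
/- Let τ be a finite tree whose vertex set is partitioned into job-vertices and machine-vertices such that every edge joins a job-vertex to a machine-vertex, rooted at a job-vertex, in which every machine-vertex has at most one child and every leaf is a machine-vertex. Then for every leaf machine-vertex i there exists a bijection g from the set of job-vertices onto the set consisting of all non-leaf machine-vertices together with i, such that g(j) is adjacent to j in τ for every job-vertex j. -/
open Finset

noncomputable section

open scoped Classical

/-- In a finite rooted tree (root `r`, parent map `par` with `par r = r` and every vertex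
reaching `r` by iterating `par`), `u` is a child of `v` iff `par u = v` and `u ≠ v`;
a leaf is a vertex with no children. -/
def IsLeaf {V : Type*} (par : V → V) (v : V) : Prop :=
  ∀ u, par u = v → u = v

/-- A vertex on the forward orbit of `i`, other than `i`, has a child on that orbit. -/
theorem exists_child_on_orbit {V : Type*} (par : V → V) (i v : V)
    (hv : ∃ n : ℕ, par^[n] i = v) (hvi : v ≠ i) :
    ∃ u, (∃ n : ℕ, par^[n] i = u) ∧ par u = v ∧ u ≠ v := by
  have hmin := fun m => Nat.find_min hv (m := m)
  have hspec := Nat.find_spec hv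
  generalize Nat.find hv = n at hmin hspec
  cases n with
  | zero => exact absurd hspec.symm hvi
  | succ k =>
    refine ⟨par^[k] i, ⟨k, rfl⟩, ?_, hmin k k.lt_succ_self⟩
    rw [← Function.iterate_succ_apply' par k i, hspec]

/-- Two vertices on the forward orbit of `i` with the same parent coincide, unless one of
them is the root. -/
theorem eq_of_par_eq_on_orbit {V : Type*} (r : V) (par : V → V) (hroot : par r = r)
    (hreach : ∀ v, ∃ n : ℕ, par^[n] v = r) (i u v : V)
    (hu : ∃ n : ℕ, par^[n] i = u) (hv : ∃ n : ℕ, par^[n] i = v)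
    (hur : u ≠ r) (hvr : v ≠ r) (huv : par u = par v) : u = v := by
  have key : ∀ a b : ℕ, a ≤ b → par^[b] i ≠ r →
      par (par^[a] i) = par (par^[b] i) → par^[a] i = par^[b] i := by
    intro a b hab hbr h
    obtain ⟨d, rfl⟩ := Nat.exists_eq_add_of_le' hab
    cases d with
    | zero => simp
    | succ d =>
      exfalso
      set w := par^[d + 1 + a] i with hw
      have hcyc : par^[d + 1] w = w := by
        have h1 : par^[d] (par w) = w := by
          rw [← h, ← Function.iterate_succ_apply, hw, Function.iterate_add_apply]
        rwa [Function.iterate_succ_apply]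
      obtain ⟨n, hn⟩ := hreach w
      have hfix : ∀ k, par^[k] r = r := fun k => Function.iterate_fixed hroot k
      have hper : par^[(d + 1) * n] w = w := by
        rw [Function.iterate_mul]
        exact Function.iterate_fixed hcyc n
      apply hbr
      rw [← hper, show (d + 1) * n = d * n + n by ring, Function.iterate_add_apply, hn, hfix]
  obtain ⟨a, rfl⟩ := hu
  obtain ⟨b, rfl⟩ := hv
  rcases le_total a b with h | h
  · exact key a b h hvr huv
  · exact (key b a h hur huv.symm).symm

/-- **Tree assignment lemma.** Let `τ` be a finite tree, bipartitioned into job-vertices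
(`job v`) and machine-vertices, rooted at a job-vertex, in which every machine-vertex has
at most one child and every leaf is a machine-vertex. Then for every leaf machine-vertex
`i` there is a bijection `g` from the job-vertices onto the set of non-leaf
machine-vertices together with `i`, such that `g j` is adjacent to `j` for every
job-vertex `j`. -/
theorem tree_job_machine_assignment
    (V : Type) [Fintype V] [DecidableEq V]
    (r : V) (par : V → V) (job : V → Prop)
    (hroot : par r = r)
    (hreach : ∀ v, ∃ n : ℕ, par^[n] v = r)
    (hjob_root : job r)
    (hbipartite : ∀ v, v ≠ r → (job v ↔ ¬ job (par v)))
    (hmachine_one_child : ∀ v, ¬ job v →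
      ∀ u u', u ≠ v → u' ≠ v → par u = v → par u' = v → u = u')
    (hleaves_machines : ∀ v, IsLeaf par v → ¬ job v)
    (i : V) (hi_machine : ¬ job i) (hi_leaf : IsLeaf par i) :
    ∃ g : V → V,
      Set.BijOn g {v | job v} ({v | ¬ job v ∧ ¬ IsLeaf par v} ∪ {i}) ∧
      ∀ j, job j → (g j = par j ∨ par (g j) = j) := by
  set P : V → Prop := fun v => ∃ n : ℕ, par^[n] i = v with hP
  have hPi : P i := ⟨0, rfl⟩
  have hPpar : ∀ v, P v → P (par v) := by
    rintro v ⟨n, rfl⟩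
    exact ⟨n + 1, Function.iterate_succ_apply' par n i⟩
  have hne_root : ∀ u, par u ≠ u → u ≠ r := by
    rintro u h rfl
    exact h hroot
  have hchild_root : ∀ u v, par u = v → u ≠ v → u ≠ r := by
    rintro u v rfl h
    exact hne_root u h.symm
  have hmachine_root : ∀ v, ¬ job v → v ≠ r := by
    rintro v h rfl
    exact h hjob_root
  have hex : ∀ v, P v → v ≠ i → ∃ u, P u ∧ par u = v ∧ u ≠ v :=
    fun v => exists_child_on_orbit par i v
  have huniq : ∀ u v, P u → P v → u ≠ r → v ≠ r → par u = par v → u = v :=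
    fun u v => eq_of_par_eq_on_orbit r par hroot hreach i u v
  have hg : ∀ j, ∃ m, job j → (P j ∧ P m ∧ par m = j ∧ m ≠ j) ∨ (¬ P j ∧ m = par j) := by
    intro j
    by_cases hj : P j
    · by_cases hji : j = i
      · exact ⟨j, fun h => absurd (hji ▸ h) hi_machine⟩
      · obtain ⟨u, hu⟩ := hex j hj hji
        exact ⟨u, fun _ => Or.inl ⟨hj, hu⟩⟩
    · exact ⟨par j, fun _ => Or.inr ⟨hj, rfl⟩⟩
  choose g hg using hg
  have hg_on : ∀ m, ¬ job m → P m → g (par m) = m := by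
    intro m hm hPm
    have hmr := hmachine_root m hm
    have hjob : job (par m) := by
      by_contra h
      exact hm ((hbipartite m hmr).2 h)
    rcases hg _ hjob with ⟨-, h1, h2, h3⟩ | ⟨h, -⟩
    · exact huniq _ _ h1 hPm (hchild_root _ _ h2 h3) hmr h2
    · exact absurd (hPpar m hPm) h
  have hPr : P r := hreach i
  have hoff : ∀ j, job j → ¬ P j → ¬ job (par j) := by
    intro j hj hPj
    exact (hbipartite j (fun h => hPj (h ▸ hPr))).1 hj
  have hmixed : ∀ j, job j → ¬ P j → ¬ P (par j) := by
    intro j hj hPj hPp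
    have hm := hoff j hj hPj
    have hne : j ≠ par j := fun h => hm (h ▸ hj)
    have hpi : par j ≠ i := fun h => hne ((hi_leaf j h).trans h.symm)
    obtain ⟨u, hPu, hu1, hu2⟩ := hex _ hPp hpi
    exact hPj (hmachine_one_child _ hm u j hu2 hne hu1 rfl ▸ hPu)
  refine ⟨g, ⟨?_, ?_, ?_⟩, ?_⟩
  · intro j hj
    rcases hg j hj with ⟨-, h1, h2, h3⟩ | ⟨h1, h2⟩
    · by_cases hgi : g j = i
      · exact Or.inr hgi
      · refine Or.inl ⟨fun h => ?_, fun h => ?_⟩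
        · exact (hbipartite _ (hchild_root _ _ h2 h3)).1 h (h2.symm ▸ hj)
        · obtain ⟨u, -, hu1, hu2⟩ := hex _ h1 hgi
          exact hu2 (h u hu1)
    · have hm := hoff j hj h1
      rw [h2]
      exact Or.inl ⟨hm, fun h => hm (h j rfl ▸ hj)⟩
  · intro j hj j' hj' hjj
    rcases hg j hj with ⟨-, h1, h2, -⟩ | ⟨h1, h2⟩ <;>
      rcases hg j' hj' with ⟨-, h3, h4, -⟩ | ⟨h3, h4⟩
    · rw [← h2, ← h4, hjj]
    · exact absurd (h4 ▸ hjj ▸ h1) (hmixed j' hj' h3)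
    · exact absurd (h2 ▸ hjj.symm ▸ h3) (hmixed j hj h1)
    · have hm := hoff j hj h1
      have hp : par j' = par j := by rw [← h2, ← h4, hjj]
      have hm' : j' ≠ par j := fun h => hm (h ▸ hj')
      exact hmachine_one_child _ hm j j' (fun h => hm (h ▸ hj)) hm' rfl hp
  · have hjob_par : ∀ m, ¬ job m → job (par m) := by
      intro m hm
      by_contra h
      exact hm ((hbipartite m (hmachine_root m hm)).2 h)
    rintro m (⟨hm, hleaf⟩ | rfl)
    · by_cases hPm : P m
      · exact ⟨par m, hjob_par m hm, hg_on m hm hPm⟩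
      · simp only [IsLeaf, not_forall] at hleaf
        obtain ⟨u, rfl, hu⟩ := hleaf
        have hju : job u := (hbipartite u (hne_root u (Ne.symm hu))).2 hm
        refine ⟨u, hju, ?_⟩
        rcases hg u hju with ⟨h, -⟩ | ⟨-, h⟩
        · exact absurd (hPpar u h) hPm
        · exact h
    · exact ⟨par m, hjob_par m hi_machine, hg_on m hi_machine hPi⟩
  · intro j hj
    rcases hg j hj with ⟨-, -, h, -⟩ | ⟨-, h⟩
    · exact Or.inr h
    · exact Or.inl h
end
end

section
/- Let c_1 ≥ 1, δ ∈ (0,1), δ_0 ∈ (0,0.001), and let I be a (q,q,0)-canonical instance with c_1·log q ≥ 50 (red machines defined with parameter δ_0). Let f be a valid assignment with X = f(J_H) such that: (i) Σ_{k∈X∩R} w_{h,k} ≤ c_1·log q for every machine h ∈ M; and (ii) φ(T) + z(T) + bnd(T) ≥ δ·|T| for every subset T ⊆ X∩R. Then f is a (δ·δ_0/(2·c_1·log q))-good assignment. -/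
open Finset

noncomputable section

open scoped Classical

/-- Deficiency of a machine `h`:
`φ h = 1 - z h - Σ_k (w k h (1 - z h) + w h k · z k)`. -/
def deficiency {M : Type*} [Fintype M] (w : M → M → ℝ) (z : M → ℝ) (h : M) : ℝ :=
  1 - z h - ∑ k, (w k h * (1 - z h) + w h k * z k)

/-- Boundary of a set `S` of machines:
`bnd S = Σ_{h ∈ S} Σ_{k ∉ S} (w k h (1 - z h) + w h k · z k)`. -/
def bnd {M : Type*} [Fintype M] [DecidableEq M] (w : M → M → ℝ) (z : M → ℝ)
    (S : Finset M) : ℝ :=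
  ∑ h ∈ S, ∑ k ∈ Sᶜ, (w k h * (1 - z h) + w h k * z k)

/-- The set `R` of red machines (w.r.t. parameter `δ₀`): those with `φ h + z h < δ₀`. -/
def redSet {M : Type*} [Fintype M] (w : M → M → ℝ) (z : M → ℝ) (δ0 : ℝ) : Finset M :=
  Finset.univ.filter (fun h => deficiency w z h + z h < δ0)

/-- Load of machine `i` when `s h k` of each light load `w h k` goes to `h` and the rest
to `k`. -/
def splitLoad {M : Type*} [Fintype M] (w s : M → M → ℝ) (i : M) : ℝ :=
  (∑ k, s i k) + ∑ h, (w h i - s h i)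

lemma splitLoad_add_single {M : Type*} [Fintype M] (w s : M → M → ℝ) (a b : M) (t : ℝ) (i : M) :
    splitLoad w (fun h k => s h k + if h = a ∧ k = b then t else 0) i =
      splitLoad w s i + ((if i = a then t else 0) - (if i = b then t else 0)) := by
  have h1 : ∑ k, (if i = a ∧ k = b then t else 0) = if i = a then t else 0 := by
    by_cases h : i = a <;> simp [h]
  have h2 : ∑ h, (if h = a ∧ i = b then t else 0) = if i = b then t else 0 := by
    by_cases h : i = b <;> simp [h]
  simp only [splitLoad, sum_add_distrib, sum_sub_distrib, h1, h2]
  ring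

/-- Effect on a sum of squares of adding `t` at `a` and removing it at `b`. -/
lemma sum_sq_transfer {M : Type*} [Fintype M] (e : M → ℝ) {a b : M} (hab : a ≠ b) (t : ℝ) :
    ∑ i, (e i + ((if i = a then t else 0) - (if i = b then t else 0))) ^ 2 =
      ∑ i, e i ^ 2 + 2 * (t * (e a - e b) + t ^ 2) := by
  have key : ∀ i, (e i + ((if i = a then t else 0) - (if i = b then t else 0))) ^ 2 =
      e i ^ 2 + ((if i = a then 2 * t * e i + t ^ 2 else 0) +
        (if i = b then -(2 * t * e i) + t ^ 2 else 0)) := by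
    intro i
    by_cases ha : i = a
    · have hb : i ≠ b := ha ▸ hab
      simp only [ha, hab, if_true, if_false]
      ring
    · by_cases hb : i = b
      · simp only [hb, hab.symm, if_true, if_false]
        ring
      · simp [ha, hb]
  simp only [key, sum_add_distrib, sum_ite_eq', mem_univ, if_true]
  ring

/-- If every load crossing out of `S` is placed outside `S`, then `S` carries exactly the loads
with both ends in `S`. -/
lemma sum_splitLoad_eq_wSum {M : Type*} [Fintype M] (w s : M → M → ℝ) (S : Finset M)
    (hout : ∀ h ∈ S, ∀ k ∉ S, s h k = 0) (hin : ∀ h ∈ S, ∀ k ∉ S, s k h = w k h) :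
    ∑ i ∈ S, splitLoad w s i = wSum w S S := by
  have h1 : ∀ i ∈ S, splitLoad w s i = (∑ k ∈ S, s i k) + ∑ k ∈ S, (w k i - s k i) := by
    intro i hi
    unfold splitLoad
    congr 1 <;> symm <;> apply sum_subset (subset_univ S)
    · exact fun k _ hk => hout i hi k hk
    · exact fun k _ hk => by rw [hin i hi k hk, sub_self]
  rw [sum_congr rfl h1, sum_add_distrib, sum_comm (s := S) (t := S) (f := fun i k => w k i - s k i),
    ← sum_add_distrib, wSum]
  refine sum_congr rfl fun i _ => ?_
  rw [← sum_add_distrib]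
  exact sum_congr rfl fun k _ => by ring

/-- Hall-type criterion: the light loads can be split within capacities `c` as soon as every set
of machines has enough capacity for the loads inside it. -/
lemma exists_splitLoad_le {M : Type*} [Fintype M] (w : M → M → ℝ) (hw : ∀ h k, 0 ≤ w h k)
    (c : M → ℝ) (hall : ∀ S : Finset M, wSum w S S ≤ ∑ h ∈ S, c h) :
    ∃ s : M → M → ℝ, (∀ h k, 0 ≤ s h k ∧ s h k ≤ w h k) ∧ ∀ i, splitLoad w s i ≤ c i := by
  have hcont : Continuous fun s : M → M → ℝ => ∑ i, (splitLoad w s i - c i) ^ 2 := by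
    unfold splitLoad
    fun_prop
  obtain ⟨s, hs, hmin⟩ := (isCompact_Icc (a := (0 : M → M → ℝ)) (b := w)).exists_isMinOn
    ⟨0, le_rfl, fun h k => hw h k⟩ hcont.continuousOn
  have hbox : ∀ h k, 0 ≤ s h k ∧ s h k ≤ w h k := fun h k => ⟨hs.1 h k, hs.2 h k⟩
  refine ⟨s, hbox, ?_⟩
  set e : M → ℝ := fun i => splitLoad w s i - c i with he
  have hvar : ∀ a b t, a ≠ b → 0 ≤ s a b + t → s a b + t ≤ w a b →
      0 ≤ t * (e a - e b) + t ^ 2 := by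
    intro a b t hab h0 h1
    have hmem : (fun h k => s h k + if h = a ∧ k = b then t else 0) ∈ Set.Icc 0 w := by
      constructor <;> intro h k <;> by_cases hk : h = a ∧ k = b
      · simpa [hk.1, hk.2] using h0
      · simpa [hk] using (hbox h k).1
      · simpa [hk.1, hk.2] using h1
      · simpa [hk] using (hbox h k).2
    have hle := isMinOn_iff.1 hmin _ hmem
    simp only [splitLoad_add_single, add_sub_right_comm] at hle
    have := sum_sq_transfer e hab t
    simp only [he] at this ⊢
    linarith
  by_contra! hex
  obtain ⟨i₀, hi₀⟩ := hex
  obtain ⟨m, -, hm⟩ := exists_max_image univ e ⟨i₀, mem_univ _⟩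
  have hpos : 0 < e m := lt_of_lt_of_le (sub_pos.2 hi₀) (hm i₀ (mem_univ _))
  set S : Finset M := univ.filter fun i => e m ≤ e i with hS
  have hgap : ∀ h ∈ S, ∀ k ∉ S, 0 < e h - e k := by
    intro h hh k hk
    simp only [hS, mem_filter, mem_univ, true_and, not_le] at hh hk
    linarith
  have hne : ∀ h ∈ S, ∀ k ∉ S, h ≠ k := fun h hh k hk hhk => hk (hhk ▸ hh)
  have hsmall : ∀ {x d : ℝ}, 0 < x → 0 < d → ∃ τ, 0 < τ ∧ τ ≤ x ∧ τ < d := fun {x d} hx hd =>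
    ⟨min x (d / 2), lt_min hx (half_pos hd), min_le_left _ _,
      (min_le_right _ _).trans_lt (half_lt_self hd)⟩
  have hout : ∀ h ∈ S, ∀ k ∉ S, s h k = 0 := by
    intro h hh k hk
    by_contra hne0
    obtain ⟨τ, hτ, hτx, hτd⟩ :=
      hsmall (lt_of_le_of_ne (hbox h k).1 (Ne.symm hne0)) (hgap h hh k hk)
    have := hvar h k (-τ) (hne h hh k hk) (by linarith) (by linarith [(hbox h k).2])
    nlinarith
  have hin : ∀ h ∈ S, ∀ k ∉ S, s k h = w k h := by
    intro h hh k hk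
    by_contra hne0
    obtain ⟨τ, hτ, hτx, hτd⟩ :=
      hsmall (sub_pos.2 (lt_of_le_of_ne (hbox k h).2 hne0)) (hgap h hh k hk)
    have := hvar k h τ (hne h hh k hk).symm (by linarith [(hbox k h).1]) (by linarith)
    nlinarith
  have hlt : ∑ i ∈ S, c i < ∑ i ∈ S, splitLoad w s i := by
    refine sum_lt_sum_of_nonempty ⟨m, by simp [hS]⟩ fun i hi => ?_
    exact sub_pos.1 (hpos.trans_le (mem_filter.1 hi).2)
  rw [sum_splitLoad_eq_wSum w s S hout hin] at hlt
  exact (hall S).not_gt hlt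

lemma wSum_add_slack_eq_card {M : Type*} [Fintype M] [DecidableEq M] (w : M → M → ℝ) (z : M → ℝ)
    (S : Finset M) :
    wSum w S S + ((∑ h ∈ S, deficiency w z h) + (∑ h ∈ S, z h) + bnd w z S) = S.card := by
  have hsplit : ∀ h, ∑ k, (w k h * (1 - z h) + w h k * z k) =
      (∑ k ∈ S, (w k h * (1 - z h) + w h k * z k)) +
        ∑ k ∈ Sᶜ, (w k h * (1 - z h) + w h k * z k) :=
    fun h => (sum_add_sum_compl S _).symm
  have hinner : ∑ h ∈ S, ∑ k ∈ S, (w k h * (1 - z h) + w h k * z k) = wSum w S S := by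
    simp only [sum_add_distrib]
    rw [sum_comm (s := S) (t := S) (f := fun h k => w h k * z k), ← sum_add_distrib, wSum,
      sum_comm (s := S) (t := S) (f := fun h k => w h k)]
    refine sum_congr rfl fun i _ => ?_
    rw [← sum_add_distrib]
    exact sum_congr rfl fun k _ => by ring
  simp only [deficiency, hsplit, sum_sub_distrib, sum_add_distrib (s := S), bnd] at hinner ⊢
  simp only [sum_const, nsmul_eq_mul, mul_one]
  linarith

/-- Passing to a subset, the boundary grows by at most `C` per removed machine. -/
lemma bnd_le_bnd_add {M : Type*} [Fintype M] [DecidableEq M] {w : M → M → ℝ} {z : M → ℝ} {C : ℝ}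
    {S T : Finset M} (hTS : T ⊆ S)
    (hnn : ∀ h k, 0 ≤ w k h * (1 - z h) + w h k * z k)
    (hC : ∀ k ∈ S \ T, ∑ h ∈ T, (w k h * (1 - z h) + w h k * z k) ≤ C) :
    bnd w z T ≤ bnd w z S + C * ((S \ T).card : ℝ) := by
  have hcompl : Tᶜ = Sᶜ ∪ (S \ T) := by
    ext x
    have := @hTS x
    simp only [mem_compl, mem_union, mem_sdiff]
    tauto
  have hdisj : Disjoint Sᶜ (S \ T) :=
    disjoint_left.2 fun x hx hx' => mem_compl.1 hx (mem_sdiff.1 hx').1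
  have h1 : bnd w z T = (∑ h ∈ T, ∑ k ∈ Sᶜ, (w k h * (1 - z h) + w h k * z k)) +
      ∑ k ∈ S \ T, ∑ h ∈ T, (w k h * (1 - z h) + w h k * z k) := by
    rw [sum_comm (s := S \ T), ← sum_add_distrib, bnd]
    exact sum_congr rfl fun h _ => by rw [hcompl, sum_union hdisj]
  have h2 : ∑ h ∈ T, ∑ k ∈ Sᶜ, (w k h * (1 - z h) + w h k * z k) ≤ bnd w z S :=
    sum_le_sum_of_subset_of_nonneg hTS fun h _ _ => sum_nonneg fun k _ => hnn h k
  have h3 := sum_le_card_nsmul (S \ T) _ C hC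
  rw [nsmul_eq_mul, mul_comm] at h3
  linarith

/-- **Lemma (reduction to subsets of X ∩ R).** Let `c₁ ≥ 1`, `δ ∈ (0,1)`,
`δ₀ ∈ (0, 0.001)`, and let `I` be a `(q, q, 0)`-canonical instance with
`c₁·log q ≥ 50`. If `f` is a valid assignment with `X = f(J_H)` such that
(i) `Σ_{k ∈ X∩R} w h k ≤ c₁ log q` for every machine `h`, and
(ii) `φ(T) + z(T) + bnd(T) ≥ δ|T|` for every `T ⊆ X∩R`,
then `f` is a `(δ·δ₀ / (2 c₁ log q))`-good assignment. -/
theorem reduce_to_star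
    (M JH : Type) [Fintype M] [DecidableEq M] [Fintype JH]
    (Mach : JH → Finset M) (w : M → M → ℝ) (z : M → ℝ)
    (q c1 δ δ0 : ℝ) (f : JH → M)
    (hc : IsPQCanonical Mach w z q q 0)
    (hc1 : 1 ≤ c1) (hδ0' : 0 < δ) (hδ1 : δ < 1)
    (hδ00 : 0 < δ0) (hδ01 : δ0 < 0.001)
    (hlog : 50 ≤ c1 * Real.log q)
    (hvalid : IsValid Mach f)
    (hA : ∀ h : M,
      ∑ k ∈ Finset.univ.image f ∩ redSet w z δ0, w h k ≤ c1 * Real.log q)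
    (hB : ∀ T ⊆ Finset.univ.image f ∩ redSet w z δ0,
      δ * (T.card : ℝ) ≤
        (∑ h ∈ T, deficiency w z h) + (∑ h ∈ T, z h) + bnd w z T) :
    IsGood w (δ * δ0 / (2 * c1 * Real.log q)) f := by
  obtain ⟨⟨-, hw, -, -, hz, -⟩, -, -, -, -, -, -, -, hload⟩ := hc
  set X := Finset.univ.image f with hX
  set R := redSet w z δ0 with hR
  have hL : 2 * c1 * Real.log q = 2 * (c1 * Real.log q) := by ring
  rw [hL]
  generalize c1 * Real.log q = L at hlog hA
  set ε := δ * δ0 / (2 * L) with hε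
  have hz1 : ∀ h, z h ≤ 0.4 := fun h => (hz h).2
  have hφ : ∀ h, 0 ≤ deficiency w z h := fun h => by
    have := hload h
    simp only [deficiency, sum_add_distrib]
    linarith
  have hnn : ∀ h k, 0 ≤ w k h * (1 - z h) + w h k * z k := fun h k =>
    add_nonneg (mul_nonneg (hw k h) (by linarith [hz1 h])) (mul_nonneg (hw h k) (hz k).1)
  have hcol : ∀ k, (∑ h, w h k) * z k ≤ 1 := fun k => by
    have h1 := hload k
    have h2 : 0 ≤ ∑ h, w h k := sum_nonneg fun h _ => hw h k
    have h3 : 0 ≤ ∑ h, w k h * z h := sum_nonneg fun h _ => mul_nonneg (hw k h) (hz h).1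
    rw [← sum_mul] at h1
    nlinarith [hz1 k, (hz k).1]
  have hall : ∀ S : Finset M,
      wSum w S S ≤ ∑ h ∈ S, (2 - ε - if h ∈ X then 1 else 0) := by
    intro S
    set T := S ∩ (X ∩ R) with hT
    set g : M → ℝ := fun h => deficiency w z h + z h + if h ∈ X then 0 else 1 with hg
    have hTS : T ⊆ S := inter_subset_left
    have hTXR : T ⊆ X ∩ R := inter_subset_right
    have hbnd : bnd w z T ≤ bnd w z S + (L + 1) * ((S \ T).card : ℝ) := by
      refine bnd_le_bnd_add hTS hnn fun k _ => ?_
      rw [sum_add_distrib, ← sum_mul]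
      refine add_le_add ?_ (le_trans ?_ (hcol k))
      · calc ∑ h ∈ T, w k h * (1 - z h) ≤ ∑ h ∈ T, w k h :=
              sum_le_sum fun h _ => mul_le_of_le_one_right (hw k h) (by linarith [(hz h).1])
          _ ≤ ∑ h ∈ X ∩ R, w k h := sum_le_sum_of_subset_of_nonneg hTXR fun h _ _ => hw k h
          _ ≤ L := hA k
      · exact mul_le_mul_of_nonneg_right
          (sum_le_sum_of_subset_of_nonneg (subset_univ T) fun h _ _ => hw h k) (hz k).1
    have hbnd0 : 0 ≤ bnd w z S := sum_nonneg fun h _ => sum_nonneg fun k _ => hnn h k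
    have hgT : (∑ h ∈ T, deficiency w z h) + ∑ h ∈ T, z h ≤ ∑ h ∈ T, g h := by
      rw [← sum_add_distrib]
      refine sum_le_sum fun h _ => ?_
      simp only [hg]
      split_ifs <;> linarith
    have hgA : δ0 * ((S \ T).card : ℝ) ≤ ∑ h ∈ S \ T, g h := by
      rw [mul_comm, ← nsmul_eq_mul]
      refine card_nsmul_le_sum _ _ _ fun h hh => ?_
      simp only [hg]
      split_ifs with hhX
      · have hred : h ∉ R := fun hhR => (mem_sdiff.1 hh).2
          (mem_inter.2 ⟨(mem_sdiff.1 hh).1, mem_inter.2 ⟨hhX, hhR⟩⟩)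
        simp only [hR, redSet, mem_filter, mem_univ, true_and, not_lt] at hred
        linarith
      · linarith [hφ h, (hz h).1]
    have hgT0 : 0 ≤ ∑ h ∈ T, g h := sum_nonneg fun h _ => by
      simp only [hg]
      split_ifs <;> linarith [hφ h, (hz h).1]
    have hgS : ∑ h ∈ S \ T, g h + ∑ h ∈ T, g h = ∑ h ∈ S, g h := sum_sdiff hTS
    have hcard : ((S \ T).card : ℝ) + T.card = S.card := by
      exact_mod_cast card_sdiff_add_card_eq_card hTS
    have hslack : ε * S.card ≤ (∑ h ∈ S, g h) + bnd w z S := by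
      have hV := hB T hTXR
      set a : ℝ := ((S \ T).card : ℝ)
      set b : ℝ := (T.card : ℝ)
      set V := (∑ h ∈ S, g h) + bnd w z S with hVdef
      have hVa : δ0 * a ≤ V := by linarith
      have hVb : δ * b ≤ V + (L + 1) * a := by
        have : 0 ≤ ∑ h ∈ S \ T, g h := le_trans (by positivity) hgA
        linarith
      have hV0 : 0 ≤ V := le_trans (by positivity) hVa
      rw [hε, div_mul_eq_mul_div, div_le_iff₀ (by linarith), ← hcard]
      have e1 := mul_le_mul_of_nonneg_left hVb hδ00.le
      have e2 := mul_le_mul_of_nonneg_left hVa (by linarith : 0 ≤ L + 1 + δ)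
      have e3 := mul_le_mul_of_nonneg_left (by linarith : δ0 + (L + 1 + δ) ≤ 2 * L) hV0
      linarith
    have hgsum : ∑ h ∈ S, g h = (∑ h ∈ S, deficiency w z h) + (∑ h ∈ S, z h) +
        ∑ h ∈ S, (1 - if h ∈ X then (1 : ℝ) else 0) := by
      rw [← sum_add_distrib, ← sum_add_distrib]
      refine sum_congr rfl fun h _ => ?_
      simp only [hg]
      split_ifs <;> ring
    have hid := wSum_add_slack_eq_card w z S
    simp only [sum_sub_distrib, sum_const, nsmul_eq_mul, mul_one] at hgsum ⊢
    linarith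
  obtain ⟨s, hs, hle⟩ := exists_splitLoad_le w hw _ hall
  refine ⟨s, hs, fun i => ?_⟩
  have := hle i
  simp only [splitLoad] at this
  linarith
end
end
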